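/- arXiv:0803.4160 — 11 statements merged into one kernel-verified Lean document; each statement's English description precedes it below -/
import Mathlib

section
/- Let H be a complex Hilbert space and let U, V be subspaces of H with U ∩ V = {0} and U + V dense in H. Then the Hilbert-space adjoint of the densely defined operator P_{U,V} is the projection P_{V^⊥,U^⊥} along V^⊥ onto U^⊥; that is, the domain of (P_{U,V})* is exactly V^⊥ + U^⊥ (note V^⊥ ∩ U^⊥ = (U+V)^⊥ = {0}), and (P_{U,V})*(x + y) = y for x ∈ V^⊥, y ∈ U^⊥. -/
open scoped InnerProductSpace in
/-- If `P` is the projection along `U` onto `V`, then `y` satisfies the identity characterizing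
`P† (x + y)` for all `x ∈ Vᗮ` and `y ∈ Uᗮ`. -/
theorem inner_eq_inner_projection_along
    {H : Type*} [NormedAddCommGroup H] [InnerProductSpace ℂ H]
    {U V : Submodule ℂ H} {P : H →ₗ.[ℂ] H} (hdom : P.domain = U ⊔ V)
    (hval : ∀ (u v : H), u ∈ U → v ∈ V → ∀ (huv : u + v ∈ P.domain),
      P ⟨u + v, huv⟩ = v)
    {x y : H} (hx : x ∈ Vᗮ) (hy : y ∈ Uᗮ) (z : P.domain) :
    ⟪y, (z : H)⟫_ℂ = ⟪x + y, P z⟫_ℂ := by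
  obtain ⟨z, hz⟩ := z
  obtain ⟨u, hu, v, hv, rfl⟩ := Submodule.mem_sup.1 (hdom ▸ hz)
  rw [hval u v hu hv hz, inner_add_left, inner_add_right,
    Submodule.inner_left_of_mem_orthogonal hu hy, Submodule.inner_left_of_mem_orthogonal hv hx]

/-- Let `H` be a complex Hilbert space and `U, V` subspaces with
`U ∩ V = {0}` and `U + V` dense in `H`. If `P` is the projection `P_{U,V}` along `U`
onto `V` (the densely defined operator with domain `U + V` sending `u + v ↦ v`),
then its Hilbert-space adjoint is the projection `P_{Vᗮ, Uᗮ}` along `Vᗮ` onto `Uᗮ`: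
note `Vᗮ ∩ Uᗮ = {0}`, the domain of `P†` is exactly `Vᗮ + Uᗮ`, and
`P† (x + y) = y` for `x ∈ Vᗮ`, `y ∈ Uᗮ`. -/
theorem adjoint_of_projection_along
    {H : Type*} [NormedAddCommGroup H] [InnerProductSpace ℂ H] [CompleteSpace H]
    (U V : Submodule ℂ H) (hUV : U ⊓ V = ⊥)
    (hdense : Dense ((U ⊔ V : Submodule ℂ H) : Set H))
    (P : H →ₗ.[ℂ] H) (hdom : P.domain = U ⊔ V)
    (hval : ∀ (u v : H), u ∈ U → v ∈ V → ∀ (huv : u + v ∈ P.domain),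
      P ⟨u + v, huv⟩ = v) :
    Vᗮ ⊓ Uᗮ = ⊥ ∧
    P.adjoint.domain = Vᗮ ⊔ Uᗮ ∧
    ∀ (x y : H), x ∈ Vᗮ → y ∈ Uᗮ → ∀ (hxy : x + y ∈ P.adjoint.domain),
      P.adjoint ⟨x + y, hxy⟩ = y := by
  have hdense' : Dense (P.domain : Set H) := hdom ▸ hdense
  refine ⟨?_, le_antisymm ?_ ?_, ?_⟩
  · rw [Submodule.inf_orthogonal, sup_comm, ← Submodule.topologicalClosure_eq_top_iff]
    exact Submodule.dense_iff_topologicalClosure_eq_top.1 hdense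
  · intro z hz
    set w : H := P.adjoint ⟨z, hz⟩
    have key : ∀ u ∈ U, ∀ v ∈ V, inner ℂ w (u + v) = inner ℂ z v := by
      intro u hu v hv
      have huv : u + v ∈ P.domain := hdom ▸ Submodule.add_mem_sup hu hv
      simpa only [hval u v hu hv huv] using
        LinearPMap.adjoint_isFormalAdjoint hdense' ⟨z, hz⟩ ⟨u + v, huv⟩
    rw [← sub_add_cancel z w]
    refine Submodule.add_mem_sup ?_ ?_
    · refine (Submodule.mem_orthogonal' V _).2 fun v hv => ?_
      rw [inner_sub_left, ← key 0 U.zero_mem v hv, zero_add, sub_self]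
    · refine (Submodule.mem_orthogonal' U _).2 fun u hu => ?_
      simpa using key u hu 0 V.zero_mem
  · intro z hz
    obtain ⟨x, hx, y, hy, rfl⟩ := Submodule.mem_sup.1 hz
    exact LinearPMap.mem_adjoint_domain_of_exists _
      ⟨y, inner_eq_inner_projection_along hdom hval hx hy⟩
  · intro x y hx hy hxy
    exact LinearPMap.adjoint_apply_eq hdense' _ (inner_eq_inner_projection_along hdom hval hx hy)
end

section
/- Let H be a complex Hilbert space and let U, V be subspaces of H with U ∩ V = {0} and U + V dense in H. The operator P_{U,V} is closable if and only if the closures satisfy cl(U) ∩ cl(V) = {0}; and in that case the closure of P_{U,V} equals P_{cl(U),cl(V)}, the projection along cl(U) onto cl(V) with domain cl(U) + cl(V). -/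
namespace LinearPMap

/-- The shear `(x, y) ↦ (x - y, y)` as a homeomorphism. -/
def subFstHomeomorph (E : Type*) [AddCommGroup E] [TopologicalSpace E]
    [IsTopologicalAddGroup E] : E × E ≃ₜ E × E where
  toFun p := (p.1 - p.2, p.2)
  invFun p := (p.1 + p.2, p.2)
  left_inv p := by simp
  right_inv p := by simp
  continuous_toFun := by fun_prop
  continuous_invFun := by fun_prop

/-- A pair `(x, y)` lies in the graph of the projection along `U` onto `V` iff `x - y ∈ U` and
`y ∈ V`. -/
theorem mem_graph_projection_iff {R E : Type*} [Ring R] [AddCommGroup E] [Module R E]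
    {U V : Submodule R E} {P : E →ₗ.[R] E} (hdom : P.domain = U ⊔ V)
    (hval : ∀ (u v : E), u ∈ U → v ∈ V → ∀ (huv : u + v ∈ P.domain), P ⟨u + v, huv⟩ = v)
    (p : E × E) : p ∈ P.graph ↔ p.1 - p.2 ∈ U ∧ p.2 ∈ V := by
  obtain ⟨x, y⟩ := p
  constructor
  · intro h
    obtain ⟨⟨z, hz⟩, rfl, rfl⟩ := (LinearPMap.mem_graph_iff P).1 h
    obtain ⟨u, hu, v, hv, rfl⟩ := Submodule.mem_sup.1 (hdom ▸ hz)
    simpa [hval u v hu hv hz] using ⟨hu, hv⟩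
  · rintro ⟨hu, hv⟩
    have hmem : x - y + y ∈ P.domain := hdom ▸ Submodule.add_mem_sup hu hv
    exact (LinearPMap.mem_graph_iff P).2 ⟨⟨_, hmem⟩, by simp, hval _ _ hu hv hmem⟩

/-- A pair `(x, y)` lies in the closure of the graph of the projection along `U` onto `V` iff
`x - y` lies in the closure of `U` and `y` in the closure of `V`. -/
theorem mem_topologicalClosure_graph_projection_iff {R E : Type*} [Ring R] [TopologicalSpace R]
    [AddCommGroup E] [TopologicalSpace E] [IsTopologicalAddGroup E] [Module R E]
    [ContinuousSMul R E]
    {U V : Submodule R E} {P : E →ₗ.[R] E} (hdom : P.domain = U ⊔ V)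
    (hval : ∀ (u v : E), u ∈ U → v ∈ V → ∀ (huv : u + v ∈ P.domain), P ⟨u + v, huv⟩ = v)
    (p : E × E) : p ∈ P.graph.topologicalClosure ↔
      p.1 - p.2 ∈ U.topologicalClosure ∧ p.2 ∈ V.topologicalClosure := by
  have hgraph : (P.graph : Set (E × E)) =
      subFstHomeomorph E ⁻¹' ((U : Set E) ×ˢ (V : Set E)) :=
    Set.ext fun q => mem_graph_projection_iff hdom hval q
  rw [← SetLike.mem_coe, Submodule.topologicalClosure_coe, hgraph,
    ← Homeomorph.preimage_closure, closure_prod_eq]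
  rfl

end LinearPMap

/-- Let `H` be a complex Hilbert space and `U, V` subspaces with
`U ∩ V = {0}` and `U + V` dense in `H`, and let `P = P_{U,V}` be the projection along
`U` onto `V`, with domain `U + V` and `P (u + v) = v`. Then `P` is closable if and only
if `cl(U) ∩ cl(V) = {0}`; and in that case the closure of `P` equals `P_{cl(U), cl(V)}`,
the projection along `cl(U)` onto `cl(V)` with domain `cl(U) + cl(V)`. -/
theorem projection_along_isClosable_iff
    {H : Type*} [NormedAddCommGroup H] [InnerProductSpace ℂ H] [CompleteSpace H]
    (U V : Submodule ℂ H) (hUV : U ⊓ V = ⊥)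
    (hdense : Dense ((U ⊔ V : Submodule ℂ H) : Set H))
    (P : H →ₗ.[ℂ] H) (hdom : P.domain = U ⊔ V)
    (hval : ∀ (u v : H), u ∈ U → v ∈ V → ∀ (huv : u + v ∈ P.domain),
      P ⟨u + v, huv⟩ = v) :
    (P.IsClosable ↔ U.topologicalClosure ⊓ V.topologicalClosure = ⊥) ∧
    (P.IsClosable →
      P.closure.domain = U.topologicalClosure ⊔ V.topologicalClosure ∧
      ∀ (u v : H), u ∈ U.topologicalClosure → v ∈ V.topologicalClosure →
        ∀ (huv : u + v ∈ P.closure.domain), P.closure ⟨u + v, huv⟩ = v) := by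
  have hmem := LinearPMap.mem_topologicalClosure_graph_projection_iff hdom hval
  refine ⟨⟨fun hP => ?_, fun h => ?_⟩, fun hP => ?_⟩
  · refine (Submodule.eq_bot_iff _).2 fun x hx => ?_
    have h0 : ((0 : H), x) ∈ P.graph.topologicalClosure :=
      (hmem _).2 ⟨by simpa only [zero_sub] using neg_mem hx.1, hx.2⟩
    rw [hP.graph_closure_eq_closure_graph] at h0
    exact P.closure.graph_fst_eq_zero_snd h0 rfl
  · refine ⟨P.graph.topologicalClosure.toLinearPMap,
      (Submodule.toLinearPMap_graph_eq _ ?_).symm⟩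
    rintro ⟨x, y⟩ hxy hx
    obtain ⟨hu, hv⟩ := (hmem _).1 hxy
    have hx' : x = 0 := hx
    have hy : y ∈ U.topologicalClosure ⊓ V.topologicalClosure :=
      Submodule.mem_inf.2 ⟨by simpa only [hx', zero_sub, neg_neg] using neg_mem hu, hv⟩
    rw [h] at hy
    exact (Submodule.mem_bot ℂ).1 hy
  · rw [hP.graph_closure_eq_closure_graph] at hmem
    refine ⟨le_antisymm (fun x hx => ?_) (fun x hx => ?_), fun u v hu hv huv => ?_⟩
    · obtain ⟨hu, hv⟩ := (hmem _).1 (P.closure.mem_graph ⟨x, hx⟩)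
      simpa using Submodule.add_mem_sup hu hv
    · obtain ⟨u, hu, v, hv, rfl⟩ := Submodule.mem_sup.1 hx
      exact LinearPMap.mem_domain_of_mem_graph ((hmem (u + v, v)).2 ⟨by simpa using hu, hv⟩)
    · exact ((LinearPMap.image_iff huv).2 ((hmem (u + v, v)).2 ⟨by simpa using hu, hv⟩)).symm
end

section
/- Let H be a complex Hilbert space and let U, V be closed subspaces of H with U ∩ V = {0} and U + V dense in H. Then the idempotent P_{U,V} is a bounded operator (i.e., there is C with ‖P_{U,V}x‖ ≤ C‖x‖ for all x ∈ U + V) if and only if U + V = H. -/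
/-- The sum map `U × V → H` is antilipschitz if and only if the projection along `U`
onto `V` is bounded. -/
theorem exists_antilipschitz_coprod_subtypeL_iff
    {𝕜 H : Type*} [NontriviallyNormedField 𝕜] [NormedAddCommGroup H] [NormedSpace 𝕜 H]
    (U V : Submodule 𝕜 H) :
    (∃ K, AntilipschitzWith K (U.subtypeL.coprod V.subtypeL)) ↔
      ∃ C : ℝ, ∀ u ∈ U, ∀ v ∈ V, ‖v‖ ≤ C * ‖u + v‖ := by
  constructor
  · rintro ⟨K, hK⟩
    refine ⟨K, fun u hu v hv => ?_⟩
    have h := hK.le_mul_norm (map_zero _) (⟨u, hu⟩, ⟨v, hv⟩)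
    exact (norm_snd_le ((⟨u, hu⟩, ⟨v, hv⟩) : U × V)).trans (by simpa using h)
  · rintro ⟨C, hC⟩
    refine ⟨1 + Real.toNNReal C,
      AddMonoidHomClass.antilipschitz_of_bound _ fun ⟨⟨u, hu⟩, ⟨v, hv⟩⟩ => ?_⟩
    have hv' : ‖v‖ ≤ max C 0 * ‖u + v‖ :=
      (hC u hu v hv).trans (by gcongr; exact le_max_left _ _)
    have hu' : ‖u‖ ≤ ‖u + v‖ + ‖v‖ := by simpa using norm_sub_le (u + v) v
    have h0 := norm_nonneg (u + v)
    simp only [Prod.norm_def, NNReal.coe_add, NNReal.coe_one, Real.coe_toNNReal',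
      ContinuousLinearMap.coprod_apply, Submodule.subtypeL_apply]
    change max ‖u‖ ‖v‖ ≤ _
    exact max_le (by linarith) (by linarith)

/-- Let `H` be a complex Hilbert space and `U, V` *closed* subspaces
with `U ∩ V = {0}` and `U + V` dense in `H`, and let `P = P_{U,V}` be the projection
along `U` onto `V`, with domain `U + V` and `P (u + v) = v`. Then the idempotent `P`
is bounded (there is `C` with `‖P x‖ ≤ C * ‖x‖` for all `x` in the domain `U + V`)
if and only if `U + V = H`. -/
theorem projection_along_bounded_iff
    {H : Type*} [NormedAddCommGroup H] [InnerProductSpace ℂ H] [CompleteSpace H]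
    (U V : Submodule ℂ H) (hUclosed : IsClosed (U : Set H)) (hVclosed : IsClosed (V : Set H))
    (hUV : U ⊓ V = ⊥)
    (hdense : Dense ((U ⊔ V : Submodule ℂ H) : Set H))
    (P : H →ₗ.[ℂ] H) (hdom : P.domain = U ⊔ V)
    (hval : ∀ (u v : H), u ∈ U → v ∈ V → ∀ (huv : u + v ∈ P.domain),
      P ⟨u + v, huv⟩ = v) :
    (∃ C : ℝ, ∀ x : P.domain, ‖P x‖ ≤ C * ‖(x : H)‖) ↔ U ⊔ V = ⊤ := by
  have hbound : (∃ C : ℝ, ∀ x : P.domain, ‖P x‖ ≤ C * ‖(x : H)‖) ↔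
      ∃ C : ℝ, ∀ u ∈ U, ∀ v ∈ V, ‖v‖ ≤ C * ‖u + v‖ := by
    refine exists_congr fun C => ⟨fun h u hu v hv => ?_, ?_⟩
    · have huv : u + v ∈ P.domain := hdom ▸ Submodule.add_mem_sup hu hv
      simpa only [hval u v hu hv huv] using h ⟨u + v, huv⟩
    · rintro h ⟨x, hx⟩
      obtain ⟨u, hu, v, hv, rfl⟩ := Submodule.mem_sup.1 (hdom ▸ hx)
      simpa only [hval u v hu hv hx] using h u hu v hv
  have : CompleteSpace U := hUclosed.completeSpace_coe
  have : CompleteSpace V := hVclosed.completeSpace_coe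
  have hinj : Function.Injective (U.subtypeL.coprod V.subtypeL) := by
    refine (injective_iff_map_eq_zero _).2 fun ⟨u, v⟩ h => ?_
    have huv : (u : H) = -v := eq_neg_of_add_eq_zero_left (by simpa using h)
    have hu : (u : H) ∈ U ⊓ V := ⟨u.2, huv ▸ V.neg_mem v.2⟩
    have hu0 : (u : H) = 0 := by simpa [hUV] using hu
    have hv0 : (v : H) = 0 := by simpa [hu0] using huv
    exact Prod.ext (Subtype.ext hu0) (Subtype.ext hv0)
  have hrange : Set.range (U.subtypeL.coprod V.subtypeL) = ((U ⊔ V : Submodule ℂ H) : Set H) := by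
    ext x
    simp [Submodule.mem_sup]
  rw [hbound, ← exists_antilipschitz_coprod_subtypeL_iff,
    ← ContinuousLinearMap.isClosed_range_iff_antilipschitz_of_injective _ hinj, hrange]
  refine ⟨fun h => SetLike.coe_injective ?_, fun h => by simp [h]⟩
  rw [← h.closure_eq, hdense.closure_eq, Submodule.top_coe]
end

section
/- Let (H, ω) be a complex symplectic vector space and let λ, μ be isotropic subspaces of H forming an algebraic Fredholm pair with nonnegative index, i.e., λ ∩ μ is finite-dimensional, the quotient H/(λ + μ) is finite-dimensional, and ind(λ,μ) := dim(λ ∩ μ) − dim(H/(λ + μ)) ≥ 0. Then λ and μ are Lagrangian subspaces of H, ind(λ,μ) = 0, (λ + μ)^ω = λ ∩ μ, and ((λ + μ)^ω)^ω = λ + μ. -/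
open Module

/-- The `ω`-annihilator `λ^ω = {x ∈ H : ω(x,y) = 0 for all y ∈ λ}` of a subspace `λ`
with respect to a sesquilinear form `ω` (conjugate-linear in the first variable,
linear in the second). -/
def symplAnn {H : Type*} [AddCommGroup H] [Module ℂ H]
    (ω : H →ₛₗ[starRingEnd ℂ] H →ₗ[ℂ] ℂ) (lam : Submodule ℂ H) : Submodule ℂ H where
  carrier := {x | ∀ y ∈ lam, ω x y = 0}
  add_mem' := by
    intro a b ha hb y hy
    simp [map_add, LinearMap.add_apply, ha y hy, hb y hy]
  zero_mem' := by
    intro y hy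
    simp
  smul_mem' := by
    intro c x hx y hy
    simp [map_smulₛₗ, LinearMap.smul_apply, hx y hy]

theorem mem_symplAnn {H : Type*} [AddCommGroup H] [Module ℂ H]
    {ω : H →ₛₗ[starRingEnd ℂ] H →ₗ[ℂ] ℂ} {V : Submodule ℂ H} {x : H} :
    x ∈ symplAnn ω V ↔ ∀ y ∈ V, ω x y = 0 := Iff.rfl

theorem symplAnn_anti {H : Type*} [AddCommGroup H] [Module ℂ H]
    (ω : H →ₛₗ[starRingEnd ℂ] H →ₗ[ℂ] ℂ) {V W : Submodule ℂ H} (h : V ≤ W) :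
    symplAnn ω W ≤ symplAnn ω V := fun _ hx y hy => hx y (h hy)

theorem symplAnn_sup {H : Type*} [AddCommGroup H] [Module ℂ H]
    (ω : H →ₛₗ[starRingEnd ℂ] H →ₗ[ℂ] ℂ) (V W : Submodule ℂ H) :
    symplAnn ω (V ⊔ W) = symplAnn ω V ⊓ symplAnn ω W := by
  refine le_antisymm (le_inf (symplAnn_anti ω le_sup_left) (symplAnn_anti ω le_sup_right)) ?_
  rintro x ⟨hV, hW⟩ y hy
  obtain ⟨a, ha, b, hb, rfl⟩ := Submodule.mem_sup.1 hy
  rw [map_add, hV a ha, hW b hb, add_zero]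

theorem le_symplAnn_symplAnn {H : Type*} [AddCommGroup H] [Module ℂ H]
    {ω : H →ₛₗ[starRingEnd ℂ] H →ₗ[ℂ] ℂ}
    (hskew : ∀ x y : H, ω y x = -(starRingEnd ℂ) (ω x y)) (V : Submodule ℂ H) :
    V ≤ symplAnn ω (symplAnn ω V) := by
  intro x hx y hy
  rw [hskew y x, hy x hx, map_zero, neg_zero]

/-- For a non-degenerate form, the annihilator of a subspace of finite codimension embeds
conjugate-linearly into the dual of the quotient. -/
theorem rank_symplAnn_le {H : Type*} [AddCommGroup H] [Module ℂ H]
    {ω : H →ₛₗ[starRingEnd ℂ] H →ₗ[ℂ] ℂ}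
    (hnondeg : ∀ x : H, (∀ y : H, ω x y = 0) → x = 0)
    (V : Submodule ℂ H) [FiniteDimensional ℂ (H ⧸ V)] :
    Module.rank ℂ (symplAnn ω V) ≤ finrank ℂ (H ⧸ V) := by
  let j : symplAnn ω V →+ Dual ℂ (H ⧸ V) :=
    { toFun := fun x => V.liftQ (ω x) fun y hy => x.2 y hy
      map_zero' := by ext; simp
      map_add' := fun x y => by ext z; exact LinearMap.congr_fun (map_add ω (x : H) y) z }
  have hj : Function.Injective j := by
    refine (injective_iff_map_eq_zero j).2 fun x hx => Subtype.ext (hnondeg x fun y => ?_)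
    exact DFunLike.congr_fun hx (V.mkQ y)
  have hle := rank_le_of_injective_injective (starRingEnd ℂ) j
    (fun r hr => (map_eq_zero (starRingEnd ℂ)).1 hr) hj
    (fun r x => by
      ext y
      have h : ω (starRingEnd ℂ r • (x : H)) y = r • ω x y := by simp
      exact h)
  rwa [← finrank_eq_rank ℂ (Dual ℂ (H ⧸ V)), Subspace.dual_finrank_eq] at hle

theorem finiteDimensional_symplAnn {H : Type*} [AddCommGroup H] [Module ℂ H]
    {ω : H →ₛₗ[starRingEnd ℂ] H →ₗ[ℂ] ℂ}
    (hnondeg : ∀ x : H, (∀ y : H, ω x y = 0) → x = 0)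
    (V : Submodule ℂ H) [FiniteDimensional ℂ (H ⧸ V)] :
    FiniteDimensional ℂ (symplAnn ω V) :=
  Module.rank_lt_aleph0_iff.1 ((rank_symplAnn_le hnondeg V).trans_lt (Cardinal.natCast_lt_aleph0))

theorem finrank_symplAnn_le {H : Type*} [AddCommGroup H] [Module ℂ H]
    {ω : H →ₛₗ[starRingEnd ℂ] H →ₗ[ℂ] ℂ}
    (hnondeg : ∀ x : H, (∀ y : H, ω x y = 0) → x = 0)
    (V : Submodule ℂ H) [FiniteDimensional ℂ (H ⧸ V)] :
    finrank ℂ (symplAnn ω V) ≤ finrank ℂ (H ⧸ V) :=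
  finrank_le_of_rank_le (rank_symplAnn_le hnondeg V)

/-- A subspace of finite codimension is determined by a larger one of at least the same
codimension. -/
theorem eq_of_le_of_finrank_quotient_le {K E : Type*} [Field K] [AddCommGroup E] [Module K E]
    {V W : Submodule K E} [FiniteDimensional K (E ⧸ V)] (h : V ≤ W)
    (hd : finrank K (E ⧸ V) ≤ finrank K (E ⧸ W)) : V = W := by
  have hsurj : Function.Surjective (Submodule.factor h) := Submodule.factor_surjective h
  have : FiniteDimensional K (E ⧸ W) := Module.Finite.of_surjective _ hsurj
  have hinj := (LinearMap.injective_iff_surjective_of_finrank_eq_finrank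
    (hd.antisymm (LinearMap.finrank_le_finrank_of_surjective hsurj))).2 hsurj
  refine le_antisymm h fun x hx => ?_
  rw [← Submodule.Quotient.mk_eq_zero V]
  refine hinj ?_
  rw [map_zero]
  exact (Submodule.Quotient.mk_eq_zero W).2 hx

/-- A subspace of finite codimension equals its double annihilator as soon as its annihilator
has the maximal possible dimension. -/
theorem symplAnn_symplAnn_eq {H : Type*} [AddCommGroup H] [Module ℂ H]
    {ω : H →ₛₗ[starRingEnd ℂ] H →ₗ[ℂ] ℂ}
    (hskew : ∀ x y : H, ω y x = -(starRingEnd ℂ) (ω x y))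
    (hnondeg : ∀ x : H, (∀ y : H, ω x y = 0) → x = 0)
    (V : Submodule ℂ H) [FiniteDimensional ℂ (H ⧸ V)]
    (hd : finrank ℂ (H ⧸ V) ≤ finrank ℂ (symplAnn ω V)) :
    symplAnn ω (symplAnn ω V) = V := by
  have hle := le_symplAnn_symplAnn hskew V
  have : FiniteDimensional ℂ (H ⧸ symplAnn ω (symplAnn ω V)) :=
    Module.Finite.of_surjective _ (Submodule.factor_surjective hle)
  have := finiteDimensional_symplAnn hnondeg (symplAnn ω (symplAnn ω V))
  refine (eq_of_le_of_finrank_quotient_le hle (hd.trans ?_)).symm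
  exact (Submodule.finrank_mono (le_symplAnn_symplAnn hskew (symplAnn ω V))).trans
    (finrank_symplAnn_le hnondeg _)

theorem eq_symplAnn_of_isotropic {H : Type*} [AddCommGroup H] [Module ℂ H]
    {ω : H →ₛₗ[starRingEnd ℂ] H →ₗ[ℂ] ℂ} {V W : Submodule ℂ H}
    (hV : V ≤ symplAnn ω V) (hW : W ≤ symplAnn ω W)
    (hsup : symplAnn ω (V ⊔ W) = V ⊓ W) (hinf : symplAnn ω (V ⊓ W) = V ⊔ W) :
    V = symplAnn ω V := by
  refine le_antisymm hV fun x hx => ?_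
  have hx' : x ∈ V ⊔ W := hinf ▸ symplAnn_anti ω inf_le_left hx
  obtain ⟨a, ha, b, hb, rfl⟩ := Submodule.mem_sup.1 hx'
  have hb' : b ∈ symplAnn ω (V ⊔ W) := by
    rw [symplAnn_sup]
    exact ⟨((symplAnn ω V).add_mem_iff_right (hV ha)).1 hx, hW hb⟩
  rw [hsup] at hb'
  exact V.add_mem ha hb'.1

/-- Let `(H, ω)` be a complex symplectic vector space (`ω` sesquilinear,
skew-Hermitian and non-degenerate) and let `λ, μ` be isotropic subspaces forming an
algebraic Fredholm pair of nonnegative index: `λ ∩ μ` is finite-dimensional,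
`H/(λ + μ)` is finite-dimensional, and
`ind(λ,μ) = dim(λ ∩ μ) − dim(H/(λ + μ)) ≥ 0`.  Then `λ` and `μ` are Lagrangian,
`ind(λ,μ) = 0`, `(λ + μ)^ω = λ ∩ μ` and `((λ + μ)^ω)^ω = λ + μ`. -/
theorem isotropic_fredholm_pair_lagrangian
    {H : Type*} [AddCommGroup H] [Module ℂ H]
    (ω : H →ₛₗ[starRingEnd ℂ] H →ₗ[ℂ] ℂ)
    (hskew : ∀ x y : H, ω y x = -(starRingEnd ℂ) (ω x y))
    (hnondeg : ∀ x : H, (∀ y : H, ω x y = 0) → x = 0)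
    (lam mu : Submodule ℂ H)
    (hlam : lam ≤ symplAnn ω lam) (hmu : mu ≤ symplAnn ω mu)
    (hfin₁ : FiniteDimensional ℂ ↥(lam ⊓ mu))
    (hfin₂ : FiniteDimensional ℂ (H ⧸ (lam ⊔ mu)))
    (hind : 0 ≤ (finrank ℂ ↥(lam ⊓ mu) : ℤ) - (finrank ℂ (H ⧸ (lam ⊔ mu)) : ℤ)) :
    lam = symplAnn ω lam ∧ mu = symplAnn ω mu ∧
    (finrank ℂ ↥(lam ⊓ mu) : ℤ) - (finrank ℂ (H ⧸ (lam ⊔ mu)) : ℤ) = 0 ∧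
    symplAnn ω (lam ⊔ mu) = lam ⊓ mu ∧
    symplAnn ω (symplAnn ω (lam ⊔ mu)) = lam ⊔ mu := by
  have hle : lam ⊓ mu ≤ symplAnn ω (lam ⊔ mu) := by
    rw [symplAnn_sup]
    exact inf_le_inf hlam hmu
  have := finiteDimensional_symplAnn hnondeg (lam ⊔ mu)
  have hd₁ := Submodule.finrank_mono hle
  have hd₂ := finrank_symplAnn_le hnondeg (lam ⊔ mu)
  have hsup : symplAnn ω (lam ⊔ mu) = lam ⊓ mu :=
    (Submodule.eq_of_le_of_finrank_le hle (by omega)).symm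
  have hdouble := symplAnn_symplAnn_eq hskew hnondeg (lam ⊔ mu) (by omega)
  have hinf : symplAnn ω (lam ⊓ mu) = lam ⊔ mu := hsup ▸ hdouble
  refine ⟨eq_symplAnn_of_isotropic hlam hmu hsup hinf, ?_, by omega, hsup, hdouble⟩
  rw [sup_comm, inf_comm] at hsup hinf
  exact eq_symplAnn_of_isotropic hmu hlam hsup hinf
end

section
/- Let (H, γ) be a strongly symplectic Hilbert space with symplectic form ω(x,y) = ⟨γx, y⟩. Let λ ⊆ H be a Lagrangian subspace, let W ⊆ H be a closed co-isotropic subspace such that λ + W^ω is closed, and let W₀ ⊆ W be a closed subspace with W₀ ∩ W^ω = {0} and W₀ + W^ω = W. Denote by P₀ the orthogonal projection of H onto W₀ and by Q₀ : W → W₀ the projection onto W₀ along W^ω. Then: (i) the bounded operator γ₀ : W₀ → W₀ given by γ₀ξ := P₀(γξ) is skew-adjoint with respect to the inner product of H restricted to W₀ and is invertible, so that ω restricted to W₀ is a strongly symplectic form on the Hilbert space W₀; and (ii) Q₀(λ ∩ W) is a Lagrangian subspace of (W₀, ω|_{W₀}), i.e., Q₀(λ ∩ W) = {x ∈ W₀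 : ω(x,y) = 0 for all y ∈ Q₀(λ ∩ W)}. -/
open scoped ComplexInnerProductSpace

/-- For a bounded operator `γ` on a complex inner product space `H`, with associated
symplectic form `ω(x,y) = ⟪γ x, y⟫`, this is the annihilator
`λ^ω = {x ∈ H : ω(x,y) = 0 for all y ∈ λ}` of a subspace `λ`. -/
def symplAnnCLM {H : Type*} [NormedAddCommGroup H] [InnerProductSpace ℂ H]
    (γ : H →L[ℂ] H) (lam : Submodule ℂ H) : Submodule ℂ H where
  carrier := {x | ∀ y ∈ lam, ⟪γ x, y⟫ = 0}
  add_mem' := by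
    intro a b ha hb y hy
    simp [map_add, inner_add_left, ha y hy, hb y hy]
  zero_mem' := by
    intro y hy
    simp
  smul_mem' := by
    intro c x hx y hy
    simp [map_smul, inner_smul_left, hx y hy]

section SymplecticAnnihilator

variable {H : Type*} [NormedAddCommGroup H] [InnerProductSpace ℂ H]

/-- If `U` and `V` are closed and disjoint with closed sum, then `Uᗮ + Vᗮ` is everything. -/
lemma exists_mem_orthogonal_add_of_disjoint [CompleteSpace H] {U V : Submodule ℂ H}
    (hU : IsClosed (U : Set H)) (hV : IsClosed (V : Set H))
    (hUV : IsClosed ((U ⊔ V : Submodule ℂ H) : Set H)) (h : U ⊓ V = ⊥) (x : H) :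
    ∃ a ∈ Uᗮ, x - a ∈ Vᗮ := by
  have : CompleteSpace U := hU.completeSpace_coe
  have : CompleteSpace V := hV.completeSpace_coe
  have : CompleteSpace (U ⊔ V : Submodule ℂ H) := hUV.completeSpace_coe
  let T : (U × V) →L[ℂ] (U ⊔ V : Submodule ℂ H) :=
    (U.subtypeL.coprod V.subtypeL).codRestrict (U ⊔ V)
      fun p => Submodule.add_mem_sup p.1.2 p.2.2
  have hT (u : U) (v : V) : ((T (u, v) : (U ⊔ V : Submodule ℂ H)) : H) = u + v := rfl
  have hker : T.ker = ⊥ := by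
    refine LinearMap.ker_eq_bot'.2 fun p hp => ?_
    obtain ⟨u, v⟩ := p
    have huv : (u : H) + v = 0 := by rw [← hT u v]; exact congrArg Subtype.val hp
    have hu : (u : H) ∈ U ⊓ V :=
      ⟨u.2, by rw [eq_neg_of_add_eq_zero_left huv]; exact V.neg_mem v.2⟩
    rw [h, Submodule.mem_bot] at hu
    rw [hu, zero_add] at huv
    exact Prod.ext (Subtype.ext hu) (Subtype.ext huv)
  have hrange : T.range = ⊤ := by
    refine LinearMap.range_eq_top.2 fun s => ?_
    obtain ⟨u, hu, v, hv, huv⟩ := Submodule.mem_sup.1 s.2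
    exact ⟨(⟨u, hu⟩, ⟨v, hv⟩), Subtype.ext ((hT _ _).trans huv)⟩
  let e := ContinuousLinearEquiv.ofBijective T hker hrange
  let f : StrongDual ℂ (U ⊔ V : Submodule ℂ H) :=
    (innerSL ℂ x ∘L V.subtypeL ∘L ContinuousLinearMap.snd ℂ U V) ∘L
      (e.symm : (U ⊔ V : Submodule ℂ H) →L[ℂ] (U × V))
  let a := (InnerProductSpace.toDual ℂ (U ⊔ V : Submodule ℂ H)).symm f
  have ha (u : U) (v : V) : ⟪(a : H), (u : H) + v⟫ = ⟪x, (v : H)⟫ := by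
    have hf : f (T (u, v)) = ⟪x, (v : H)⟫ := by
      have : e.symm (T (u, v)) = (u, v) := e.symm_apply_apply (u, v)
      simp [f, this]
    rw [← hT u v, ← Submodule.coe_inner, InnerProductSpace.toDual_symm_apply, hf]
  refine ⟨a, (Submodule.mem_orthogonal' _ _).2 fun u hu => ?_,
    (Submodule.mem_orthogonal' _ _).2 fun v hv => ?_⟩
  · simpa using ha ⟨u, hu⟩ 0
  · have := ha 0 ⟨v, hv⟩
    rw [inner_sub_left, sub_eq_zero]
    simpa using this.symm

variable {γ : H →L[ℂ] H}

lemma isClosed_symplAnnCLM (U : Submodule ℂ H) : IsClosed (symplAnnCLM γ U : Set H) := by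
  have : (symplAnnCLM γ U : Set H) = γ ⁻¹' (Uᗮ : Set H) := by
    ext x
    exact (Submodule.mem_orthogonal' U (γ x)).symm
  rw [this]
  exact U.isClosed_orthogonal.preimage γ.continuous

lemma symplAnnCLM_sup (U V : Submodule ℂ H) :
    symplAnnCLM γ (U ⊔ V) = symplAnnCLM γ U ⊓ symplAnnCLM γ V := by
  refine le_antisymm (fun x hx => ⟨fun y hy => hx y (Submodule.mem_sup_left hy),
    fun y hy => hx y (Submodule.mem_sup_right hy)⟩) ?_
  rintro x ⟨hU, hV⟩ y hy
  obtain ⟨u, hu, v, hv, rfl⟩ := Submodule.mem_sup.1 hy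
  rw [inner_add_right, hU u hu, hV v hv, add_zero]

variable [CompleteSpace H]

lemma inner_map_left_of_skew (hγ : ContinuousLinearMap.adjoint γ = -γ) (x y : H) :
    ⟪γ x, y⟫ = -⟪x, γ y⟫ := by
  rw [← ContinuousLinearMap.adjoint_inner_right, hγ]
  simp

lemma inner_map_eq_zero_comm (hγ : ContinuousLinearMap.adjoint γ = -γ) {x y : H} :
    ⟪γ x, y⟫ = 0 ↔ ⟪γ y, x⟫ = 0 := by
  rw [inner_map_left_of_skew hγ, neg_eq_zero, inner_eq_zero_symm]

/-- A closed subspace equals its double symplectic annihilator. -/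
lemma symplAnnCLM_symplAnnCLM (hγ : ContinuousLinearMap.adjoint γ = -γ)
    (hsurj : Function.Surjective γ) {U : Submodule ℂ H} (hU : IsClosed (U : Set H)) :
    symplAnnCLM γ (symplAnnCLM γ U) = U := by
  refine le_antisymm (fun x hx => ?_) fun x hx y hy => (inner_map_eq_zero_comm hγ).1 (hy x hx)
  have : CompleteSpace U := hU.completeSpace_coe
  rw [← U.orthogonal_orthogonal, Submodule.mem_orthogonal]
  intro z hz
  obtain ⟨y, rfl⟩ := hsurj z
  exact (inner_map_eq_zero_comm hγ).1 (hx y ((Submodule.mem_orthogonal' _ _).1 hz))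

end SymplecticAnnihilator

/-- **symplectic reduction.**  Let `(H, γ)` be a strongly symplectic
Hilbert space (`γ` bounded, invertible, `γ* = −γ`) with symplectic form
`ω(x,y) = ⟪γx, y⟫`.  Let `λ` be a Lagrangian subspace, `W` a closed co-isotropic
subspace with `λ + W^ω` closed, and `W₀ ⊆ W` a closed subspace with
`W₀ ∩ W^ω = {0}` and `W₀ + W^ω = W`.  Let `P₀` be the orthogonal projection of `H`
onto `W₀` and let `Q₀(λ ∩ W)` denote the image of `λ ∩ W` under the projection onto
`W₀` along `W^ω`.  Then (i) `γ₀ := P₀ ∘ γ` restricted to `W₀` is skew-adjoint for the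
restricted inner product and bijective from `W₀` onto `W₀` (so `ω|_{W₀}` is a strongly
symplectic form on the Hilbert space `W₀`), and (ii) `Q₀(λ ∩ W)` is a Lagrangian
subspace of `(W₀, ω|_{W₀})`. -/
theorem symplectic_reduction
    {H : Type*} [NormedAddCommGroup H] [InnerProductSpace ℂ H] [CompleteSpace H]
    (γ : H →L[ℂ] H) (hγinv : IsUnit γ)
    (hγskew : ContinuousLinearMap.adjoint γ = -γ)
    (lam W W₀ : Submodule ℂ H)
    (hlam : lam = symplAnnCLM γ lam)
    (hWclosed : IsClosed (W : Set H))
    (hWcoiso : symplAnnCLM γ W ≤ W)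
    (hsumclosed : IsClosed ((lam ⊔ symplAnnCLM γ W : Submodule ℂ H) : Set H))
    (hW₀closed : IsClosed (W₀ : Set H))
    (hW₀le : W₀ ≤ W)
    (hmeet : W₀ ⊓ symplAnnCLM γ W = ⊥)
    (hjoin : W₀ ⊔ symplAnnCLM γ W = W)
    (P₀ : H →L[ℂ] H)
    (hP₀ : ∀ x : H, P₀ x ∈ W₀ ∧ x - P₀ x ∈ W₀ᗮ) :
    (∀ ξ ∈ W₀, ∀ η ∈ W₀, ⟪P₀ (γ ξ), η⟫ = -⟪ξ, P₀ (γ η)⟫) ∧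
    Set.BijOn (fun x => P₀ (γ x)) (W₀ : Set H) (W₀ : Set H) ∧
    (∀ L : Set H,
      L = {x | x ∈ W₀ ∧ ∃ w, w ∈ lam ⊓ W ∧ w - x ∈ symplAnnCLM γ W} →
      L = {x | x ∈ W₀ ∧ ∀ y ∈ L, ⟪γ x, y⟫ = 0}) := by
  have hsurj : Function.Surjective γ := by
    obtain ⟨δ, hδ⟩ := hγinv.exists_right_inv
    exact fun y => ⟨δ y, by simpa using congrArg (fun f : H →L[ℂ] H => f y) hδ⟩
  have hP (x : H) {η : H} (hη : η ∈ W₀) : ⟪P₀ x, η⟫ = ⟪x, η⟫ := by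
    have := (Submodule.mem_orthogonal' _ _).1 (hP₀ x).2 η hη
    rw [inner_sub_left, sub_eq_zero] at this
    exact this.symm
  have hWW : symplAnnCLM γ (symplAnnCLM γ W) = W := symplAnnCLM_symplAnnCLM hγskew hsurj hWclosed
  have hann {x n : H} (hx : x ∈ W) (hn : n ∈ symplAnnCLM γ W) : ⟪γ x, n⟫ = 0 :=
    (inner_map_eq_zero_comm hγskew).1 (hn x hx)
  have hdecomp {x : H} (hx : x ∈ W) : ∃ q ∈ W₀, x - q ∈ symplAnnCLM γ W := by
    rw [← hjoin] at hx
    obtain ⟨q, hq, n, hn, rfl⟩ := Submodule.mem_sup.1 hx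
    exact ⟨q, hq, by rwa [add_sub_cancel_left]⟩
  refine ⟨fun ξ hξ η hη => ?_, ⟨fun x _ => (hP₀ (γ x)).1, ?_, ?_⟩, ?_⟩
  · rw [hP _ hη, inner_map_left_of_skew hγskew, ← inner_conj_symm ξ (P₀ (γ η)), hP _ hξ,
      inner_conj_symm]
  · intro x hx y hy hxy
    have hd : x - y ∈ W₀ := W₀.sub_mem hx hy
    have hzero : P₀ (γ (x - y)) = 0 := by
      rw [map_sub, map_sub, sub_eq_zero]
      exact hxy
    have hmem : x - y ∈ W₀ ⊓ symplAnnCLM γ W := by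
      refine ⟨hd, fun z hz => ?_⟩
      obtain ⟨q, hq, hn⟩ := hdecomp hz
      rw [← add_sub_cancel q z, inner_add_right, hann (hW₀le hd) hn, ← hP _ hq, hzero,
        inner_zero_left, add_zero]
    rw [hmeet, Submodule.mem_bot] at hmem
    exact sub_eq_zero.1 hmem
  · intro η hη
    obtain ⟨a, ha, hηa⟩ := exists_mem_orthogonal_add_of_disjoint (isClosed_symplAnnCLM W)
      hW₀closed (by rwa [sup_comm, hjoin]) (by rwa [inf_comm]) η
    obtain ⟨u, rfl⟩ := hsurj a
    have hu : u ∈ W := by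
      rw [← hWW]
      exact (Submodule.mem_orthogonal' _ _).1 ha
    obtain ⟨ξ, hξ, hn⟩ := hdecomp hu
    refine ⟨ξ, hξ, ?_⟩
    have hd : P₀ (γ ξ) - η ∈ W₀ := W₀.sub_mem (hP₀ _).1 hη
    have horth : ⟪P₀ (γ ξ) - η, P₀ (γ ξ) - η⟫ = 0 := by
      have h1 := (Submodule.mem_orthogonal' _ _).1 hηa _ hd
      have h2 := hn _ (hW₀le hd)
      rw [inner_sub_left] at h1
      rw [map_sub, inner_sub_left] at h2
      rw [inner_sub_left, hP _ hd]
      linear_combination -h1 - h2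
    exact sub_eq_zero.1 (inner_self_eq_zero.1 horth)
  · intro L hL
    have hclosed : symplAnnCLM γ (lam ⊓ W) = lam ⊔ symplAnnCLM γ W := by
      have := symplAnnCLM_symplAnnCLM hγskew hsurj hsumclosed
      rwa [symplAnnCLM_sup, ← hlam, hWW] at this
    ext x
    constructor
    · intro hx
      rw [hL] at hx
      obtain ⟨hx₀, w, ⟨hwl, hwW⟩, hwx⟩ := hx
      refine ⟨hx₀, fun y hy => ?_⟩
      rw [hL] at hy
      obtain ⟨hy₀, v, ⟨hvl, hvW⟩, hvy⟩ := hy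
      have h1 := hwx y (hW₀le hy₀)
      have h2 := hann hwW hvy
      have h3 : ⟪γ w, v⟫ = 0 := by
        rw [hlam] at hwl
        exact hwl v hvl
      rw [map_sub, inner_sub_left] at h1
      rw [inner_sub_right] at h2
      linear_combination h3 - h1 - h2
    · rintro ⟨hx₀, hx⟩
      have hxann : x ∈ symplAnnCLM γ (lam ⊓ W) := by
        intro w hw
        obtain ⟨q, hq, hn⟩ := hdecomp hw.2
        have hqL : q ∈ L := by
          rw [hL]
          exact ⟨hq, w, hw, hn⟩
        rw [← add_sub_cancel q w, inner_add_right, hx q hqL, hann (hW₀le hx₀) hn, add_zero]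
      rw [hclosed] at hxann
      obtain ⟨l, hl, n, hn, rfl⟩ := Submodule.mem_sup.1 hxann
      have hln : l - (l + n) ∈ symplAnnCLM γ W := by
        rw [sub_add_cancel_left]
        exact Submodule.neg_mem _ hn
      rw [hL]
      refine ⟨hx₀, l, ⟨hl, ?_⟩, hln⟩
      rw [← add_sub_cancel_right l n]
      exact W.sub_mem (hW₀le hx₀) (hWcoiso hn)
end

section
/- Let H be a finite-dimensional complex inner product space, let J be an invertible skew-adjoint endomorphism of H (J* = −J), and let B be a selfadjoint endomorphism of H with JB = −BJ. Then ker B is invariant under J, the restriction of iJ to ker B is a selfadjoint endomorphism of ker B, and sign(iJ) = sign((iJ)|_{ker B}). -/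
open scoped ComplexInnerProductSpace
open Module

/-- The signature of a (selfadjoint) endomorphism `A` of a finite-dimensional complex
inner product space: the dimension of the sum of the eigenspaces of `A` for positive
(real) eigenvalues minus the dimension of the sum of the eigenspaces for negative
(real) eigenvalues. -/
noncomputable def signEnd {E : Type*} [AddCommGroup E] [Module ℂ E]
    (A : E →ₗ[ℂ] E) : ℤ :=
  (finrank ℂ ↥(⨆ μ : ℝ, ⨆ _ : 0 < μ, Module.End.eigenspace A (μ : ℂ)) : ℤ) -
  (finrank ℂ ↥(⨆ μ : ℝ, ⨆ _ : μ < 0, Module.End.eigenspace A (μ : ℂ)) : ℤ)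

open Submodule

/-- The sum of the eigenspaces of `f` for the scalars in `S`. -/
noncomputable def eigenspaceSum {K V : Type*} [Field K] [AddCommGroup V] [Module K V]
    (f : End K V) (S : Set K) : Submodule K V :=
  ⨆ μ ∈ S, f.eigenspace μ

section EigenspaceSum

variable {K V : Type*} [Field K] [AddCommGroup V] [Module K V]

lemma map_eigenspaceSum_le {f g : End K V} {S T : Set K}
    (h : ∀ μ ∈ S, ∃ ν ∈ T, (f.eigenspace μ).map g ≤ f.eigenspace ν) :
    (eigenspaceSum f S).map g ≤ eigenspaceSum f T := by
  simp only [eigenspaceSum, Submodule.map_iSup]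
  refine iSup₂_le fun μ hμ => ?_
  obtain ⟨ν, hν, hle⟩ := h μ hμ
  exact hle.trans (le_biSup f.eigenspace hν)

lemma eigenspaceSum_invariant (f : End K V) (S : Set K) :
    ∀ x ∈ eigenspaceSum f S, f x ∈ eigenspaceSum f S := by
  refine map_le_iff_le_comap.mp (map_eigenspaceSum_le fun μ hμ => ⟨μ, hμ, ?_⟩)
  rintro _ ⟨x, hx, rfl⟩
  rw [End.mem_eigenspace_iff.mp hx]
  exact smul_mem _ μ hx

/-- An invariant subspace meets a sum of eigenspaces in the sum of its intersections with them. -/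
lemma inf_eigenspaceSum [FiniteDimensional K V] {f : End K V} {p : Submodule K V}
    (hp : ∀ x ∈ p, f x ∈ p) (S : Set K) :
    p ⊓ eigenspaceSum f S = ⨆ μ ∈ S, p ⊓ f.eigenspace μ := by
  refine le_antisymm ?_ (le_inf (iSup₂_le fun _ _ => inf_le_left)
    (iSup₂_mono fun _ _ => inf_le_right))
  have hq : ∀ x ∈ p ⊓ eigenspaceSum f S, f x ∈ p ⊓ eigenspaceSum f S := fun x hx =>
    ⟨hp x hx.1, eigenspaceSum_invariant f S x hx.2⟩
  have hle : p ⊓ eigenspaceSum f S ≤ ⨆ μ, f.eigenspace μ :=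
    inf_le_right.trans (iSup₂_le fun μ _ => le_iSup f.eigenspace μ)
  rw [← inf_eq_left.mpr hle]
  refine (inf_iSup_genEigenspace hq 1).le.trans (iSup_le fun μ => ?_)
  by_cases hμ : μ ∈ S
  · exact le_iSup₂_of_le μ hμ (inf_le_inf_right _ inf_le_left)
  · have hdisj : Disjoint (f.eigenspace μ) (eigenspaceSum f S) :=
      f.eigenspaces_iSupIndep.disjoint_biSup hμ
    exact (hdisj.symm.mono_left inf_le_right).le_bot.trans bot_le

lemma map_subtype_eigenspaceSum_restrict [FiniteDimensional K V] {f : End K V}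
    {p : Submodule K V} (hp : ∀ x ∈ p, f x ∈ p) (S : Set K) :
    (eigenspaceSum (f.restrict hp) S).map p.subtype = p ⊓ eigenspaceSum f S := by
  rw [inf_eigenspaceSum hp]
  simp only [eigenspaceSum, Submodule.map_iSup]
  exact biSup_congr fun μ _ => (p.inf_genEigenspace f hp).symm

lemma finrank_eigenspaceSum_restrict [FiniteDimensional K V] {f : End K V}
    {p : Submodule K V} (hp : ∀ x ∈ p, f x ∈ p) (S : Set K) :
    finrank K (eigenspaceSum (f.restrict hp) S) = finrank K ↥(p ⊓ eigenspaceSum f S) := by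
  rw [← map_subtype_eigenspaceSum_restrict hp, finrank_map_subtype_eq]

lemma finrank_map_add_finrank_ker_inf {W : Type*} [AddCommGroup W] [Module K W]
    [FiniteDimensional K V] (g : V →ₗ[K] W) (p : Submodule K V) :
    finrank K (p.map g) + finrank K ↥(LinearMap.ker g ⊓ p) = finrank K p := by
  rw [← (g.domRestrict p).finrank_range_add_finrank_ker, LinearMap.range_domRestrict,
    LinearMap.ker_domRestrict, ← finrank_map_subtype_eq, map_comap_subtype, inf_comm]

end EigenspaceSum

lemma LinearMap.IsSymmetric.finrank_map_le_of_map_le {𝕜 E : Type*} [RCLike 𝕜]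
    [NormedAddCommGroup E] [InnerProductSpace 𝕜 E] [FiniteDimensional 𝕜 E] {B : E →ₗ[𝕜] E}
    (hB : B.IsSymmetric) {p q : Submodule 𝕜 E} (h : p.map B ≤ q) :
    finrank 𝕜 (p.map B) ≤ finrank 𝕜 (q.map B) := by
  have hker : LinearMap.ker B ⊓ p.map B = ⊥ := by
    rw [eq_bot_iff]
    rintro _ ⟨hx, y, -, rfl⟩
    rw [mem_bot, ← inner_self_eq_zero (𝕜 := 𝕜), hB, LinearMap.mem_ker.mp hx, inner_zero_right]
  have := finrank_map_add_finrank_ker_inf B (p.map B)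
  rw [hker, finrank_bot, add_zero] at this
  rw [← this]
  exact finrank_mono (map_mono h)

lemma signEnd_eq {E : Type*} [AddCommGroup E] [Module ℂ E] (A : E →ₗ[ℂ] E) :
    signEnd A = finrank ℂ (eigenspaceSum A ((fun μ : ℝ => (μ : ℂ)) '' Set.Ioi 0)) -
      finrank ℂ (eigenspaceSum A ((fun μ : ℝ => (μ : ℂ)) '' Set.Iio 0)) := by
  rw [eigenspaceSum, eigenspaceSum, iSup_image, iSup_image]
  rfl

lemma map_eigenspace_le_of_anticommute {R M : Type*} [CommRing R] [AddCommGroup M] [Module R M]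
    {A B : End R M} (h : ∀ x, A (B x) = -B (A x)) (μ : R) :
    (A.eigenspace μ).map B ≤ A.eigenspace (-μ) := by
  rintro _ ⟨x, hx, rfl⟩
  rw [SetLike.mem_coe, End.mem_eigenspace_iff] at hx
  rw [End.mem_eigenspace_iff, h, hx, map_smul, neg_smul]

/-- If a symmetric `B` anticommutes with `A`, then `A` has the same signature as its restriction
to `ker B`. -/
lemma signEnd_restrict_ker_of_anticommute {E : Type*} [NormedAddCommGroup E]
    [InnerProductSpace ℂ E] [FiniteDimensional ℂ E] {A B : E →ₗ[ℂ] E} (hB : B.IsSymmetric)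
    (hAB : ∀ x, A (B x) = -B (A x)) (h : ∀ x ∈ LinearMap.ker B, A x ∈ LinearMap.ker B) :
    signEnd A = signEnd (A.restrict h) := by
  rw [signEnd_eq, signEnd_eq, finrank_eigenspaceSum_restrict h, finrank_eigenspaceSum_restrict h]
  set P := eigenspaceSum A ((fun μ : ℝ => (μ : ℂ)) '' Set.Ioi 0)
  set N := eigenspaceSum A ((fun μ : ℝ => (μ : ℂ)) '' Set.Iio 0)
  have hPN : P.map B ≤ N := map_eigenspaceSum_le <| by
    rintro _ ⟨μ, hμ, rfl⟩
    exact ⟨-μ, ⟨-μ, by simpa using hμ, by simp⟩, map_eigenspace_le_of_anticommute hAB _⟩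
  have hNP : N.map B ≤ P := map_eigenspaceSum_le <| by
    rintro _ ⟨μ, hμ, rfl⟩
    exact ⟨-μ, ⟨-μ, by simpa using hμ, by simp⟩, map_eigenspace_le_of_anticommute hAB _⟩
  have h₁ := hB.finrank_map_le_of_map_le hPN
  have h₂ := hB.finrank_map_le_of_map_le hNP
  have h₃ := finrank_map_add_finrank_ker_inf B P
  have h₄ := finrank_map_add_finrank_ker_inf B N
  lia

/-- Let `H` be a finite-dimensional complex inner product space,
`J` an invertible skew-adjoint endomorphism (`J* = −J`) and `B` a selfadjoint
endomorphism with `JB = −BJ`.  Then `ker B` is invariant under `J`, the restriction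
of `iJ` to `ker B` is a selfadjoint endomorphism of `ker B`, and
`sign(iJ) = sign((iJ)|_{ker B})`. -/
theorem signature_restriction_kernel
    {H : Type*} [NormedAddCommGroup H] [InnerProductSpace ℂ H] [FiniteDimensional ℂ H]
    (J B : H →ₗ[ℂ] H)
    (hJinv : Function.Bijective J)
    (hJskew : LinearMap.adjoint J = -J)
    (hBsa : LinearMap.IsSymmetric B)
    (hJB : J ∘ₗ B = -(B ∘ₗ J)) :
    (∀ x ∈ LinearMap.ker B, J x ∈ LinearMap.ker B) ∧
    ∀ h : ∀ x ∈ LinearMap.ker B, (Complex.I • J) x ∈ LinearMap.ker B,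
      LinearMap.IsSymmetric ((Complex.I • J).restrict h) ∧
      signEnd (Complex.I • J) = signEnd ((Complex.I • J).restrict h) := by
  have hanti : ∀ x, J (B x) = -B (J x) := fun x => LinearMap.congr_fun hJB x
  refine ⟨fun x hx => ?_, fun h => ⟨LinearMap.IsSymmetric.restrict_invariant ?_ h,
    signEnd_restrict_ker_of_anticommute hBsa (fun x => ?_) h⟩⟩
  · rw [LinearMap.mem_ker, ← neg_eq_zero, ← hanti, LinearMap.mem_ker.mp hx, map_zero]
  · rw [LinearMap.isSymmetric_iff_isSelfAdjoint, isSelfAdjoint_iff, star_smul,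
      LinearMap.star_eq_adjoint, hJskew]
    simp
  · simp [hanti]
end

section
/- Let H be a finite-dimensional complex inner product space and let γ be an injective skew-adjoint endomorphism of H (γ* = −γ), so that iγ is selfadjoint and invertible. Then there exists a subspace λ of H with λ = (γλ)^⊥ (i.e., a Lagrangian subspace for the symplectic form ω(x,y) = ⟨γx,y⟩) if and only if sign(iγ) = 0. -/
open Module

open scoped InnerProductSpace

namespace LinearMap.IsSymmetric

variable {H : Type*} [NormedAddCommGroup H] [InnerProductSpace ℂ H] {A : H →ₗ[ℂ] H}

/-- Distinct eigenvalues of a symmetric operator have orthogonal eigenspaces. -/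
theorem inner_eq_zero_of_eigenvalue_ne (hA : A.IsSymmetric) {μ ν : ℝ} (h : μ ≠ ν) {x y : H}
    (hx : A x = (μ : ℂ) • x) (hy : A y = (ν : ℂ) • y) : ⟪x, y⟫_ℂ = 0 := by
  have h1 := hA x y
  rw [hx, hy, inner_smul_left, inner_smul_right, Complex.conj_ofReal] at h1
  have h2 : ((μ : ℂ) - ν) * ⟪x, y⟫_ℂ = 0 := by linear_combination h1
  exact (mul_eq_zero.mp h2).resolve_left (sub_ne_zero.mpr (Complex.ofReal_injective.ne h))

theorem isOrtho_iSup_eigenspace (hA : A.IsSymmetric) {p q : ℝ → Prop}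
    (hpq : ∀ μ, p μ → ¬ q μ) :
    (⨆ μ : ℝ, ⨆ _ : p μ, Module.End.eigenspace A (μ : ℂ)) ⟂
      (⨆ μ : ℝ, ⨆ _ : q μ, Module.End.eigenspace A (μ : ℂ)) := by
  simp only [Submodule.isOrtho_iSup_left, Submodule.isOrtho_iSup_right]
  intro ν hν μ hμ
  rw [Submodule.isOrtho_iff_inner_eq]
  intro x hx y hy
  refine hA.inner_eq_zero_of_eigenvalue_ne ?_
    (Module.End.mem_eigenspace_iff.mp hx) (Module.End.mem_eigenspace_iff.mp hy)
  rintro rfl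
  exact hpq _ hμ hν

theorem mapsTo_iSup_eigenspace (A : H →ₗ[ℂ] H) (p : ℝ → Prop) :
    ∀ x ∈ (⨆ μ : ℝ, ⨆ _ : p μ, Module.End.eigenspace A (μ : ℂ)),
      A x ∈ (⨆ μ : ℝ, ⨆ _ : p μ, Module.End.eigenspace A (μ : ℂ)) := by
  change (⨆ μ : ℝ, ⨆ _ : p μ, Module.End.eigenspace A (μ : ℂ)) ≤
    Submodule.comap A (⨆ μ : ℝ, ⨆ _ : p μ, Module.End.eigenspace A (μ : ℂ))
  refine iSup₂_le fun μ hμ x hx => ?_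
  rw [Submodule.mem_comap, Module.End.mem_eigenspace_iff.mp hx]
  exact Submodule.smul_mem _ _
    ((le_iSup₂ (f := fun (μ : ℝ) (_ : p μ) => Module.End.eigenspace A (μ : ℂ)) μ hμ) hx)

variable [FiniteDimensional ℂ H]

/-- The sum of the eigenspaces for eigenvalues satisfying `p` has an orthonormal basis of
eigenvectors whose eigenvalues satisfy `p`. -/
theorem exists_orthonormalBasis_iSup_eigenspace (hA : A.IsSymmetric) (p : ℝ → Prop) {k : ℕ}
    (hk : finrank ℂ ↥(⨆ μ : ℝ, ⨆ _ : p μ, Module.End.eigenspace A (μ : ℂ)) = k) :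
    ∃ (b : OrthonormalBasis (Fin k) ℂ ↥(⨆ μ : ℝ, ⨆ _ : p μ, Module.End.eigenspace A (μ : ℂ)))
      (μ : Fin k → ℝ), ∀ i, p (μ i) ∧ A (b i : H) = (μ i : ℂ) • (b i : H) := by
  have hS := hA.restrict_invariant (mapsTo_iSup_eigenspace A p)
  have happ (i : Fin k) : A (hS.eigenvectorBasis hk i : H) =
      (hS.eigenvalues hk i : ℂ) • (hS.eigenvectorBasis hk i : H) :=
    congrArg Subtype.val (hS.apply_eigenvectorBasis hk i)
  refine ⟨hS.eigenvectorBasis hk, hS.eigenvalues hk, fun i => ⟨?_, happ i⟩⟩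
  by_contra hp
  have hmem : (hS.eigenvectorBasis hk i : H) ∈
      ⨆ ν : ℝ, ⨆ _ : ν = hS.eigenvalues hk i, Module.End.eigenspace A (ν : ℂ) :=
    (le_iSup₂ (f := fun (ν : ℝ) (_ : ν = hS.eigenvalues hk i) => Module.End.eigenspace A (ν : ℂ)) _ rfl)
      (Module.End.mem_eigenspace_iff.mpr (happ i))
  have hortho := hA.isOrtho_iSup_eigenspace (p := p) (q := fun ν => ν = hS.eigenvalues hk i)
    (fun ν hν h => hp (h ▸ hν))
  have h0 := Submodule.isOrtho_iff_inner_eq.mp hortho _ (hS.eigenvectorBasis hk i).2 _ hmem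
  rw [inner_self_eq_zero] at h0
  exact (hS.eigenvectorBasis hk).orthonormal.ne_zero i (Subtype.ext h0)

theorem exists_inner_apply_self_eq_sum (hA : A.IsSymmetric) (p : ℝ → Prop) {x : H}
    (hx : x ∈ ⨆ μ : ℝ, ⨆ _ : p μ, Module.End.eigenspace A (μ : ℂ)) :
    ∃ (k : ℕ) (μ : Fin k → ℝ) (c : Fin k → ℂ), (∀ i, p (μ i)) ∧
      ⟪A x, x⟫_ℂ = ((∑ i, μ i * ‖c i‖ ^ 2 : ℝ) : ℂ) ∧ (c = 0 → x = 0) := by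
  obtain ⟨b, μ, hb⟩ := hA.exists_orthonormalBasis_iSup_eigenspace p rfl
  refine ⟨_, μ, fun i => b.repr ⟨x, hx⟩ i, fun i => (hb i).1, ?_, fun hc => ?_⟩
  · have hAx : ⟨A x, mapsTo_iSup_eigenspace A p x hx⟩ =
        ∑ i, (b.repr ⟨x, hx⟩ i * μ i) • b i := by
      apply Subtype.ext
      have h := congrArg (fun y => A (Subtype.val y)) (b.sum_repr ⟨x, hx⟩)
      simpa [hb, mul_smul] using h.symm
    have h : ⟪A x, x⟫_ℂ = ⟪(⟨A x, mapsTo_iSup_eigenspace A p x hx⟩ :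
        ↥(⨆ μ : ℝ, ⨆ _ : p μ, Module.End.eigenspace A (μ : ℂ))), ⟨x, hx⟩⟫_ℂ := rfl
    rw [h, hAx, sum_inner]
    push_cast
    refine Finset.sum_congr rfl fun i _ => ?_
    rw [inner_smul_left, ← b.repr_apply_apply, map_mul, Complex.conj_ofReal, mul_right_comm,
      Complex.conj_mul', mul_comm]
  · have h0 : b.repr ⟨x, hx⟩ = 0 := by
      ext i
      exact congrFun hc i
    exact congrArg Subtype.val (b.repr.map_eq_zero_iff.mp h0)

theorem eq_zero_of_mem_iSup_eigenspace_pos (hA : A.IsSymmetric) {x : H}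
    (hx : x ∈ ⨆ μ : ℝ, ⨆ _ : 0 < μ, Module.End.eigenspace A (μ : ℂ)) (h : ⟪A x, x⟫_ℂ = 0) : x = 0 := by
  obtain ⟨k, μ, c, hμ, hsum, hc⟩ := hA.exists_inner_apply_self_eq_sum (0 < ·) hx
  rw [h, eq_comm, Complex.ofReal_eq_zero, Finset.sum_eq_zero_iff_of_nonneg
    fun i _ => mul_nonneg (hμ i).le (sq_nonneg _)] at hsum
  refine hc (funext fun i => ?_)
  simpa [(hμ i).ne'] using hsum i (Finset.mem_univ i)

theorem eq_zero_of_mem_iSup_eigenspace_neg (hA : A.IsSymmetric) {x : H}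
    (hx : x ∈ ⨆ μ : ℝ, ⨆ _ : μ < 0, Module.End.eigenspace A (μ : ℂ)) (h : ⟪A x, x⟫_ℂ = 0) : x = 0 := by
  obtain ⟨k, μ, c, hμ, hsum, hc⟩ := hA.exists_inner_apply_self_eq_sum (· < 0) hx
  rw [h, eq_comm, Complex.ofReal_eq_zero, Finset.sum_eq_zero_iff_of_nonpos
    fun i _ => mul_nonpos_of_nonpos_of_nonneg (hμ i).le (sq_nonneg _)] at hsum
  refine hc (funext fun i => ?_)
  simpa [(hμ i).ne] using hsum i (Finset.mem_univ i)

theorem iSup_eigenspace_pos_sup_neg_eq_top (hA : A.IsSymmetric) (hinj : Function.Injective A) :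
    (⨆ μ : ℝ, ⨆ _ : 0 < μ, Module.End.eigenspace A (μ : ℂ)) ⊔
      (⨆ μ : ℝ, ⨆ _ : μ < 0, Module.End.eigenspace A (μ : ℂ)) = ⊤ := by
  have htop := Submodule.orthogonal_eq_bot_iff.mp hA.orthogonalComplement_iSup_eigenspaces_eq_bot
  rw [eq_top_iff, ← htop]
  refine iSup_le fun μ => ?_
  by_cases hμ : Module.End.HasEigenvalue A μ
  · obtain ⟨r, rfl⟩ : ∃ r : ℝ, (r : ℂ) = μ :=
      Complex.conj_eq_iff_real.mp (hA.conj_eigenvalue_eq_self hμ) |>.imp fun _ => Eq.symm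
    rcases lt_trichotomy r 0 with hr | rfl | hr
    · exact le_sup_of_le_right
        (le_iSup₂ (f := fun (μ : ℝ) (_ : μ < 0) => Module.End.eigenspace A (μ : ℂ)) r hr)
    · simp [Module.End.eigenspace_zero, LinearMap.ker_eq_bot.mpr hinj]
    · exact le_sup_of_le_left
        (le_iSup₂ (f := fun (μ : ℝ) (_ : 0 < μ) => Module.End.eigenspace A (μ : ℂ)) r hr)
  · rw [Module.End.hasEigenvalue_iff, not_not] at hμ
    simp [hμ]

theorem finrank_iSup_eigenspace_pos_add_neg (hA : A.IsSymmetric) (hinj : Function.Injective A) :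
    finrank ℂ ↥(⨆ μ : ℝ, ⨆ _ : 0 < μ, Module.End.eigenspace A (μ : ℂ)) +
      finrank ℂ ↥(⨆ μ : ℝ, ⨆ _ : μ < 0, Module.End.eigenspace A (μ : ℂ)) = finrank ℂ H := by
  have hd := (hA.isOrtho_iSup_eigenspace (p := (0 < ·)) (q := (· < 0))
    fun μ h => h.le.not_gt).disjoint
  rw [← Submodule.finrank_sup_add_finrank_inf_eq, hd.eq_bot,
    hA.iSup_eigenspace_pos_sup_neg_eq_top hinj, finrank_top, finrank_bot, add_zero]

theorem signEnd_eq_zero_of_eq_orthogonal_map (hA : A.IsSymmetric) (hinj : Function.Injective A)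
    {L : Submodule ℂ H} (hL : L = (L.map A)ᗮ) : signEnd A = 0 := by
  have hiso (x : H) (hx : x ∈ L) : ⟪A x, x⟫_ℂ = 0 := by
    have hx' := hx
    rw [hL] at hx'
    exact hx' _ (Submodule.mem_map_of_mem hx)
  have hdim : finrank ℂ L + finrank ℂ L = finrank ℂ H := by
    have h := (L.map A).finrank_add_finrank_orthogonal
    rwa [← hL, ← (L.equivMapOfInjective A hinj).finrank_eq] at h
  have hsum := hA.finrank_iSup_eigenspace_pos_add_neg hinj
  have hpos := Submodule.finrank_add_finrank_le_of_disjoint (Submodule.disjoint_def.mpr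
    fun x hx hP => hA.eq_zero_of_mem_iSup_eigenspace_pos hP (hiso x hx))
  have hneg := Submodule.finrank_add_finrank_le_of_disjoint (Submodule.disjoint_def.mpr
    fun x hx hN => hA.eq_zero_of_mem_iSup_eigenspace_neg hN (hiso x hx))
  unfold signEnd
  omega

theorem exists_eq_orthogonal_map_of_signEnd_eq_zero (hA : A.IsSymmetric)
    (hinj : Function.Injective A) (hsign : signEnd A = 0) :
    ∃ L : Submodule ℂ H, L = (L.map A)ᗮ := by
  have hsum := hA.finrank_iSup_eigenspace_pos_add_neg hinj
  unfold signEnd at hsign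
  obtain ⟨k, hk⟩ : ∃ k, finrank ℂ ↥(⨆ μ : ℝ, ⨆ _ : 0 < μ, Module.End.eigenspace A (μ : ℂ)) = k :=
    ⟨_, rfl⟩
  have hk' : finrank ℂ ↥(⨆ μ : ℝ, ⨆ _ : μ < 0, Module.End.eigenspace A (μ : ℂ)) = k := by omega
  obtain ⟨b, μ, hb⟩ := hA.exists_orthonormalBasis_iSup_eigenspace (0 < ·) hk
  obtain ⟨c, ν, hc⟩ := hA.exists_orthonormalBasis_iSup_eigenspace (· < 0) hk'
  have hortho := hA.isOrtho_iSup_eigenspace (p := (0 < ·)) (q := (· < 0)) fun μ h => h.le.not_gt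
  have hbc (i j : Fin k) : ⟪(b i : H), (c j : H)⟫_ℂ = 0 :=
    Submodule.isOrtho_iff_inner_eq.mp hortho _ (b i).2 _ (c j).2
  have hcb (i j : Fin k) : ⟪(c i : H), (b j : H)⟫_ℂ = 0 := inner_eq_zero_symm.mp (hbc j i)
  have hbb (i j : Fin k) : ⟪(b i : H), (b j : H)⟫_ℂ = if i = j then 1 else 0 :=
    orthonormal_iff_ite.mp b.orthonormal i j
  have hcc (i j : Fin k) : ⟪(c i : H), (c j : H)⟫_ℂ = if i = j then 1 else 0 :=
    orthonormal_iff_ite.mp c.orthonormal i j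
  let v (i : Fin k) : H := ((√(-ν i) : ℝ) : ℂ) • (b i : H) + ((√(μ i) : ℝ) : ℂ) • (c i : H)
  have hAv (i j : Fin k) : ⟪A (v i), v j⟫_ℂ = 0 := by
    simp only [v, map_add, map_smul, (hb i).2, (hc i).2, inner_add_left, inner_add_right,
      inner_smul_left, inner_smul_right, hbc, hcb, hbb, hcc, Complex.conj_ofReal]
    split_ifs with h
    · subst h
      have h1 := Real.mul_self_sqrt (neg_nonneg.mpr (hc i).1.le)
      have h2 := Real.mul_self_sqrt (hb i).1.le
      norm_cast
      linear_combination μ i * h1 + ν i * h2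
    · simp
  have hvv (i j : Fin k) (hij : i ≠ j) : ⟪v i, v j⟫_ℂ = 0 := by
    simp only [v, inner_add_left, inner_add_right, inner_smul_left, inner_smul_right,
      hbc, hcb, hbb, hcc, if_neg hij, mul_zero, add_zero]
  have hv0 (i : Fin k) : v i ≠ 0 := fun h => by
    have h1 : ⟪(c i : H), v i⟫_ℂ = 0 := by rw [h, inner_zero_right]
    simp only [v, inner_add_right, inner_smul_right, hcb, hcc, if_true, mul_zero, zero_add, mul_one,
      Complex.ofReal_eq_zero] at h1
    exact (Real.sqrt_pos.mpr (hb i).1).ne' h1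
  have hdim : finrank ℂ ↥(Submodule.span ℂ (Set.range v)) = k := by
    rw [finrank_span_eq_card (linearIndependent_of_ne_zero_of_inner_eq_zero hv0 hvv),
      Fintype.card_fin]
  refine ⟨Submodule.span ℂ (Set.range v), Submodule.eq_of_le_of_finrank_eq ?_ ?_⟩
  · rw [← Submodule.isOrtho_iff_le, Submodule.map_span, Submodule.isOrtho_span]
    rintro _ ⟨j, rfl⟩ _ ⟨_, ⟨i, rfl⟩, rfl⟩
    exact inner_eq_zero_symm.mp (hAv i j)
  · have h := ((Submodule.span ℂ (Set.range v)).map A).finrank_add_finrank_orthogonal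
    rw [← (Submodule.equivMapOfInjective A hinj _).finrank_eq] at h
    omega

end LinearMap.IsSymmetric

/-- Let `H` be a finite-dimensional complex inner product space and
`γ` an injective skew-adjoint endomorphism (`γ* = −γ`), so that `iγ` is selfadjoint
and invertible.  Then there is a subspace `λ` with `λ = (γλ)ᗮ` (a Lagrangian subspace
for the symplectic form `ω(x,y) = ⟪γx, y⟫`) if and only if `sign(iγ) = 0`. -/
theorem exists_lagrangian_iff_sign_zero
    {H : Type*} [NormedAddCommGroup H] [InnerProductSpace ℂ H] [FiniteDimensional ℂ H]
    (γ : H →ₗ[ℂ] H)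
    (hγinj : Function.Injective γ)
    (hγskew : LinearMap.adjoint γ = -γ) :
    (∃ lam : Submodule ℂ H, lam = (lam.map γ)ᗮ) ↔ signEnd (Complex.I • γ) = 0 := by
  have hsymm : (Complex.I • γ).IsSymmetric := by
    rw [LinearMap.isSymmetric_iff_isSelfAdjoint, LinearMap.isSelfAdjoint_iff']
    rw [LinearEquiv.map_smulₛₗ, hγskew]
    simp
  have hinj : Function.Injective (Complex.I • γ) :=
    (smul_right_injective H Complex.I_ne_zero).comp hγinj
  simp only [← Submodule.map_smul γ _ Complex.I Complex.I_ne_zero]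
  exact ⟨fun ⟨_, h⟩ => hsymm.signEnd_eq_zero_of_eq_orthogonal_map hinj h,
    hsymm.exists_eq_orthogonal_map_of_signEnd_eq_zero hinj⟩
end

section
/- Let H be a complex Hilbert space, S a topological space, s₀ ∈ S, and J : S → B(H) a norm-continuous family of bounded operators such that for every s ∈ S one has J(s)* = −J(s), J(s)² = −Id, and ‖Id + J(s)J(s₀)‖ < 2. Then for each s the operator Z(s) := (1/2)(Id − J(s)J(s₀)) is invertible and normal, satisfies J(s)Z(s) = Z(s)J(s₀), and Z(s)Z(s)* commutes with both J(s) and J(s₀); moreover U(s) := Z(s)(Z(s)*Z(s))^{−1/2} is a unitary operator depending norm-continuously on s, and J(s) = U(s) J(s₀) U(s)* for all s ∈ S. -/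
open ContinuousLinearMap

section CStarAlgebra

variable {A : Type*} [CStarAlgebra A]

/-- If `J` and `K` are complex structures, `Z = ½(1 - JK)` intertwines them. -/
lemma complexStructure_mul_intertwiner {J K Z : A} (hJ : J * J = -1) (hK : K * K = -1)
    (hZ : Z = (2 : ℂ)⁻¹ • (1 - J * K)) : J * Z = Z * K := by
  have h₁ : J * (J * K) = -K := by rw [← mul_assoc, hJ, neg_one_mul]
  have h₂ : J * K * K = -J := by rw [mul_assoc, hK, mul_neg_one]
  rw [hZ, mul_smul_comm, smul_mul_assoc, mul_sub, sub_mul, mul_one, one_mul, h₁, h₂]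
  congr 1
  abel

lemma star_intertwiner {J K Z : A} (hJs : star J = -J) (hKs : star K = -K)
    (hZ : Z = (2 : ℂ)⁻¹ • (1 - J * K)) : star Z = (2 : ℂ)⁻¹ • (1 - K * J) := by
  simp [hZ, star_smul, hJs, hKs]

/-- The intertwiner `Z = ½(1 - JK)` is normal. -/
lemma isStarNormal_intertwiner {J K Z : A} (hJ : J * J = -1) (hK : K * K = -1)
    (hJs : star J = -J) (hKs : star K = -K)
    (hZ : Z = (2 : ℂ)⁻¹ • (1 - J * K)) : IsStarNormal Z := by
  have h₁ : J * K * (K * J) = 1 := by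
    rw [mul_assoc, ← mul_assoc K K J, hK, neg_one_mul, mul_neg, hJ, neg_neg]
  have h₂ : K * J * (J * K) = 1 := by
    rw [mul_assoc, ← mul_assoc J J K, hJ, neg_one_mul, mul_neg, hK, neg_neg]
  have h : Commute (K * J) (J * K) := h₂.trans h₁.symm
  refine ⟨?_⟩
  rw [star_intertwiner hJs hKs hZ, hZ]
  exact ((((Commute.one_left _).sub_left
    ((Commute.one_right _).sub_right h)).smul_left _).smul_right _)

/-- The intertwiner `Z = ½(1 - JK)` is invertible as soon as `‖1 + JK‖ < 2`. -/
lemma isUnit_intertwiner {J K Z : A} (hZ : Z = (2 : ℂ)⁻¹ • (1 - J * K))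
    (hn : ‖1 + J * K‖ < 2) : IsUnit Z := by
  have h : Z = 1 - (2 : ℂ)⁻¹ • (1 + J * K) := by
    rw [hZ]
    module
  rw [h]
  refine isUnit_one_sub_of_norm_lt_one ?_
  rw [norm_smul, norm_inv, Complex.norm_ofNat]
  linarith

lemma star_intertwiner_mul {J K Z : A} (hJs : star J = -J) (hKs : star K = -K)
    (h : J * Z = Z * K) : star Z * J = K * star Z := by
  simpa [hJs, hKs] using congrArg star h

variable [PartialOrder A] [StarOrderedRing A]

lemma isStrictlyPositive_star_mul_self {Z : A} (hZ : IsUnit Z) :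
    IsStrictlyPositive (star Z * Z) :=
  IsStrictlyPositive.iff_of_unital.mpr ⟨star_mul_self_nonneg Z, hZ.star.mul hZ⟩

lemma rpow_neg_half_mul_self {a : A} (ha : IsStrictlyPositive a) :
    a ^ (-1 / 2 : ℝ) * a ^ (-1 / 2 : ℝ) * a = 1 := by
  have hnn := ha.nonneg
  rw [← CFC.rpow_add ha.isUnit]
  nth_rw 2 [← CFC.rpow_one a]
  rw [← CFC.rpow_add ha.isUnit]
  norm_num [CFC.rpow_zero a]

lemma Commute.cfcRpow {a b : A} (h : Commute a b) (r : ℝ) : Commute (a ^ r) b :=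
  h.cfc_nnreal _

lemma continuous_mul_rpow_star_mul_self {S : Type*} [TopologicalSpace S] {Z : S → A}
    (hZ : Continuous Z) (hu : ∀ s, IsUnit (Z s)) (r : ℝ) :
    Continuous fun s ↦ Z s * (star (Z s) * Z s) ^ r :=
  hZ.mul ((CFC.continuousOn_rpow r).comp_continuous (hZ.star.mul hZ)
    fun s ↦ isStrictlyPositive_star_mul_self (hu s))

end CStarAlgebra

/-- Let `H` be a complex Hilbert space, `S` a topological space,
`s₀ ∈ S`, and `J : S → B(H)` a norm-continuous family with `J(s)* = −J(s)`,
`J(s)² = −Id` and `‖Id + J(s)J(s₀)‖ < 2` for all `s`.  Then for each `s` the operator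
`Z(s) := ½(Id − J(s)J(s₀))` is invertible and normal, satisfies
`J(s)Z(s) = Z(s)J(s₀)`, and `Z(s)Z(s)*` commutes with both `J(s)` and `J(s₀)`;
moreover `U(s) := Z(s)(Z(s)*Z(s))^{−1/2}` (characterized by `U(s) = Z(s) R(s)` with
`R(s)` the unique positive operator with `R(s)² = (Z(s)*Z(s))⁻¹`) is a unitary
operator depending norm-continuously on `s`, and `J(s) = U(s) J(s₀) U(s)*`. -/
theorem unitary_conjugation_family
    {H S : Type*} [NormedAddCommGroup H] [InnerProductSpace ℂ H] [CompleteSpace H]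
    [TopologicalSpace S] (s₀ : S)
    (J : S → H →L[ℂ] H) (hJcont : Continuous J)
    (hskew : ∀ s, ContinuousLinearMap.adjoint (J s) = -(J s))
    (hsq : ∀ s, J s ∘L J s = -1)
    (hnorm : ∀ s, ‖(1 : H →L[ℂ] H) + J s ∘L J s₀‖ < 2) :
    ∀ Z : S → H →L[ℂ] H,
      (∀ s, Z s = (2 : ℂ)⁻¹ • ((1 : H →L[ℂ] H) - J s ∘L J s₀)) →
      (∀ s,
        IsUnit (Z s) ∧
        Z s ∘L ContinuousLinearMap.adjoint (Z s) =
          ContinuousLinearMap.adjoint (Z s) ∘L Z s ∧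
        J s ∘L Z s = Z s ∘L J s₀ ∧
        Commute (Z s ∘L ContinuousLinearMap.adjoint (Z s)) (J s) ∧
        Commute (Z s ∘L ContinuousLinearMap.adjoint (Z s)) (J s₀)) ∧
      ∃ U : S → H →L[ℂ] H, Continuous U ∧ ∀ s,
        (∃ R : H →L[ℂ] H, R.IsPositive ∧
          (R ∘L R) ∘L (ContinuousLinearMap.adjoint (Z s) ∘L Z s) = 1 ∧
          (ContinuousLinearMap.adjoint (Z s) ∘L Z s) ∘L (R ∘L R) = 1 ∧
          U s = Z s ∘L R) ∧
        ContinuousLinearMap.adjoint (U s) ∘L U s = 1 ∧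
        U s ∘L ContinuousLinearMap.adjoint (U s) = 1 ∧
        J s = (U s ∘L J s₀) ∘L ContinuousLinearMap.adjoint (U s) := by
  intro Z hZ
  have hs : ∀ s, star (J s) = -J s := hskew
  have hu : ∀ s, IsUnit (Z s) := fun s ↦ isUnit_intertwiner (hZ s) (hnorm s)
  have hn : ∀ s, star (Z s) * Z s = Z s * star (Z s) := fun s ↦
    (isStarNormal_intertwiner (hsq s) (hsq s₀) (hs s) (hs s₀) (hZ s)).star_comm_self
  have hint : ∀ s, J s * Z s = Z s * J s₀ := fun s ↦
    complexStructure_mul_intertwiner (hsq s) (hsq s₀) (hZ s)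
  have hint' : ∀ s, star (Z s) * J s = J s₀ * star (Z s) := fun s ↦
    star_intertwiner_mul (hs s) (hs s₀) (hint s)
  have hcJ : ∀ s, Commute (Z s * star (Z s)) (J s) := fun s ↦ by
    rw [commute_iff_eq, mul_assoc, hint', ← mul_assoc, ← hint, mul_assoc]
  have hcJ₀ : ∀ s, Commute (star (Z s) * Z s) (J s₀) := fun s ↦ by
    rw [commute_iff_eq, mul_assoc, ← hint, ← mul_assoc, hint', mul_assoc]
  refine ⟨fun s ↦ ⟨hu s, (hn s).symm, hint s, hcJ s, ?_⟩, ?_⟩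
  · have h := hcJ₀ s
    rw [hn s] at h
    exact h
  have hZc : Continuous Z := by
    have h : Z = fun s ↦ (2 : ℂ)⁻¹ • (1 - J s * J s₀) := funext hZ
    rw [h]
    exact (continuous_const.sub (hJcont.mul continuous_const)).const_smul (2 : ℂ)⁻¹
  refine ⟨fun s ↦ Z s * (star (Z s) * Z s) ^ (-1 / 2 : ℝ),
    continuous_mul_rpow_star_mul_self hZc hu _, fun s ↦ ?_⟩
  have hRR := rpow_neg_half_mul_self (isStrictlyPositive_star_mul_self (hu s))
  have hRnn : 0 ≤ (star (Z s) * Z s) ^ (-1 / 2 : ℝ) := CFC.rpow_nonneg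
  have hRJ := (hcJ₀ s).cfcRpow (-1 / 2)
  have hRP := (Commute.refl (star (Z s) * Z s)).cfcRpow (-1 / 2)
  have hRZ := Commute.cfcRpow (a := star (Z s) * Z s) (b := Z s)
    (by rw [commute_iff_eq, ← mul_assoc, ← hn]) (-1 / 2)
  set R := (star (Z s) * Z s) ^ (-1 / 2 : ℝ)
  have hRs : star R = R := (IsSelfAdjoint.of_nonneg hRnn).star_eq
  have hPRR : star (Z s) * Z s * (R * R) = 1 := by
    rw [← (hRP.mul_left hRP).eq, hRR]
  have hUs : star (Z s * R) = R * star (Z s) := by rw [star_mul, hRs]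
  have hRR' : Z s * (R * R) * star (Z s) = 1 := by
    rw [← (hRZ.mul_left hRZ).eq, mul_assoc, ← hn, hRR]
  refine ⟨⟨R, (ContinuousLinearMap.nonneg_iff_isPositive R).mp hRnn, hRR, hPRR, rfl⟩, ?_, ?_, ?_⟩
  · change star (Z s * R) * (Z s * R) = 1
    rw [hUs, mul_assoc, ← mul_assoc (star (Z s)), ← hRP.eq, ← mul_assoc, hRR]
  · change Z s * R * star (Z s * R) = 1
    rw [hUs, ← mul_assoc, mul_assoc (Z s), hRR']
  · change J s = Z s * R * J s₀ * star (Z s * R)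
    rw [hUs, mul_assoc (Z s), hRJ.eq, ← mul_assoc (Z s), ← hint]
    calc J s = J s * (Z s * (R * R) * star (Z s)) := by rw [hRR', mul_one]
      _ = J s * Z s * R * (R * star (Z s)) := by simp only [mul_assoc]
end

section
/- Let E be a finite-dimensional complex inner product space and let b be an endomorphism of E none of whose eigenvalues lies on the imaginary axis iℝ. Then the orthogonal complement of the sum of the generalized eigenspaces of b for eigenvalues with positive real part equals the sum of the generalized eigenspaces of the adjoint b* for eigenvalues with negative real part; in particular E is the orthogonal direct sum of these two subspaces. -/
namespace Module.End

variable {E : Type*} [NormedAddCommGroup E] [InnerProductSpace ℂ E] [FiniteDimensional ℂ E]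

theorem adjoint_sub_algebraMap_pow (b : End ℂ E) (μ : ℂ) (n : ℕ) :
    LinearMap.adjoint ((b - algebraMap ℂ (End ℂ E) μ) ^ n) =
      (LinearMap.adjoint b - algebraMap ℂ (End ℂ E) (starRingEnd ℂ μ)) ^ n := by
  simp only [← LinearMap.star_eq_adjoint, star_pow, star_sub, Algebra.algebraMap_eq_smul_one,
    star_smul, star_one, starRingEnd_apply]

theorem hasEigenvalue_adjoint_iff {b : End ℂ E} {μ : ℂ} :
    HasEigenvalue (LinearMap.adjoint b) μ ↔ HasEigenvalue b (starRingEnd ℂ μ) := by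
  rw [hasEigenvalue_iff_mem_spectrum, hasEigenvalue_iff_mem_spectrum, ← LinearMap.star_eq_adjoint,
    spectrum.map_star, Set.mem_star, starRingEnd_apply]

theorem isOrtho_maxGenEigenspace_adjoint (b : End ℂ E) {μ ν : ℂ} (h : starRingEnd ℂ μ ≠ ν) :
    maxGenEigenspace b μ ⟂ maxGenEigenspace (LinearMap.adjoint b) ν := by
  rw [Submodule.isOrtho_comm, Submodule.isOrtho_iff_le, maxGenEigenspace_eq_genEigenspace_finrank b,
    genEigenspace_nat, LinearMap.orthogonal_ker, ← Algebra.algebraMap_eq_smul_one,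
    adjoint_sub_algebraMap_pow]
  set n := Module.finrank ℂ E
  set G := maxGenEigenspace (LinearMap.adjoint b) ν
  set T := (LinearMap.adjoint b - algebraMap ℂ (End ℂ E) (starRingEnd ℂ μ)) ^ n with hT
  have hmaps : ∀ x ∈ G, T x ∈ G :=
    mapsTo_maxGenEigenspace_of_comm
      (((Commute.refl _).sub_right (Algebra.commute_algebraMap_right _ _)).pow_right _) ν
  have hinj : Function.Injective (T.restrict hmaps) := by
    rw [← LinearMap.ker_eq_bot, LinearMap.ker_eq_bot']
    rintro ⟨x, hx⟩ hx0
    have hx' : x ∈ maxGenEigenspace (LinearMap.adjoint b) (starRingEnd ℂ μ) :=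
      (mem_maxGenEigenspace _ _ _).2 ⟨n, by simpa [hT, Algebra.algebraMap_eq_smul_one] using congrArg Subtype.val hx0⟩
    simpa using (disjoint_genEigenspace _ h _ _).le_bot ⟨hx', hx⟩
  intro x hx
  obtain ⟨y, hy⟩ := LinearMap.injective_iff_surjective.1 hinj ⟨x, hx⟩
  exact ⟨y, congrArg Subtype.val hy⟩

/-- The orthogonal complement of a sum of generalized eigenspaces of `b` is the sum of the
generalized eigenspaces of the adjoint at the conjugates of the remaining scalars. -/
theorem orthogonal_iSup_maxGenEigenspace (b : End ℂ E) (S : Set ℂ) :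
    (⨆ μ ∈ S, maxGenEigenspace b μ)ᗮ =
      ⨆ ν : ℂ, ⨆ _ : starRingEnd ℂ ν ∉ S, maxGenEigenspace (LinearMap.adjoint b) ν := by
  have ortho (T : Set ℂ) : (⨆ μ ∈ T, maxGenEigenspace b μ) ⟂
      ⨆ ν : ℂ, ⨆ _ : starRingEnd ℂ ν ∉ T, maxGenEigenspace (LinearMap.adjoint b) ν := by
    simp only [Submodule.isOrtho_iSup_left, Submodule.isOrtho_iSup_right]
    intro μ hμ ν hν
    exact isOrtho_maxGenEigenspace_adjoint b (by rintro rfl; simp_all)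
  refine le_antisymm (fun x hx ↦ ?_) (ortho S).symm.le
  have hsup : (⨆ ν : ℂ, ⨆ _ : starRingEnd ℂ ν ∉ Sᶜ, maxGenEigenspace (LinearMap.adjoint b) ν) ⊔
      (⨆ ν : ℂ, ⨆ _ : starRingEnd ℂ ν ∉ S, maxGenEigenspace (LinearMap.adjoint b) ν) = ⊤ := by
    rw [eq_top_iff, ← iSup_maxGenEigenspace_eq_top (LinearMap.adjoint b)]
    refine iSup_le fun ν ↦ ?_
    by_cases hν : starRingEnd ℂ ν ∈ S
    · exact le_sup_of_le_left (le_iSup₂_of_le ν (not_not.2 hν) le_rfl)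
    · exact le_sup_of_le_right (le_iSup₂_of_le ν hν le_rfl)
  obtain ⟨p, hp, m, hm, rfl⟩ := Submodule.mem_sup.1 (hsup ▸ Submodule.mem_top : x ∈ _)
  have hpS : p ∈ (⨆ μ ∈ S, maxGenEigenspace b μ)ᗮ :=
    (Submodule.add_mem_iff_left _ ((ortho S).symm.le hm)).1 hx
  have htop : (⨆ μ ∈ S, maxGenEigenspace b μ) ⊔ (⨆ μ ∈ Sᶜ, maxGenEigenspace b μ) = ⊤ := by
    rw [← iSup_union, Set.union_compl_self, iSup_univ, iSup_maxGenEigenspace_eq_top]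
  have hp0 : p ∈ ((⨆ μ ∈ S, maxGenEigenspace b μ) ⊔ (⨆ μ ∈ Sᶜ, maxGenEigenspace b μ))ᗮ := by
    rw [← Submodule.inf_orthogonal]
    exact ⟨hpS, (ortho Sᶜ).symm.le hp⟩
  rw [htop, Submodule.top_orthogonal_eq_bot, Submodule.mem_bot] at hp0
  simpa [hp0] using hm

end Module.End


/-- Let `E` be a finite-dimensional complex inner product space and
`b` an endomorphism none of whose eigenvalues lies on the imaginary axis.  Then the
orthogonal complement of the sum `V₊` of the generalized eigenspaces of `b` for
eigenvalues with positive real part equals the sum `V₋` of the generalized eigenspaces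
of the adjoint `b*` for eigenvalues with negative real part; in particular `E` is the
(orthogonal) direct sum of `V₊` and `V₋`. -/
theorem orthogonal_complement_generalized_eigenspaces
    {E : Type*} [NormedAddCommGroup E] [InnerProductSpace ℂ E] [FiniteDimensional ℂ E]
    (b : E →ₗ[ℂ] E)
    (hb : ∀ μ : ℂ, Module.End.HasEigenvalue b μ → μ.re ≠ 0) :
    (⨆ μ : ℂ, ⨆ _ : 0 < μ.re, Module.End.maxGenEigenspace b μ)ᗮ =
      (⨆ μ : ℂ, ⨆ _ : μ.re < 0, Module.End.maxGenEigenspace (LinearMap.adjoint b) μ) ∧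
    (⨆ μ : ℂ, ⨆ _ : 0 < μ.re, Module.End.maxGenEigenspace b μ) ⊓
      (⨆ μ : ℂ, ⨆ _ : μ.re < 0, Module.End.maxGenEigenspace (LinearMap.adjoint b) μ) = ⊥ ∧
    (⨆ μ : ℂ, ⨆ _ : 0 < μ.re, Module.End.maxGenEigenspace b μ) ⊔
      (⨆ μ : ℂ, ⨆ _ : μ.re < 0, Module.End.maxGenEigenspace (LinearMap.adjoint b) μ) = ⊤ := by
  have key : (⨆ μ : ℂ, ⨆ _ : 0 < μ.re, Module.End.maxGenEigenspace b μ)ᗮ =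
      ⨆ μ : ℂ, ⨆ _ : μ.re < 0, Module.End.maxGenEigenspace (LinearMap.adjoint b) μ := by
    refine (Module.End.orthogonal_iSup_maxGenEigenspace b {μ | 0 < μ.re}).trans ?_
    simp only [Set.mem_ofPred_eq, Complex.conj_re, not_lt]
    refine le_antisymm (iSup₂_le fun ν hν ↦ ?_)
      (iSup₂_le fun ν hν ↦ le_iSup₂_of_le ν hν.le le_rfl)
    rcases hν.lt_or_eq with hν | hν
    · exact le_iSup₂_of_le ν hν le_rfl
    · have hbot : Module.End.maxGenEigenspace (LinearMap.adjoint b) ν = ⊥ := by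
        by_contra hne
        have hev : Module.End.HasEigenvalue (LinearMap.adjoint b) ν :=
          Module.End.HasUnifEigenvalue.lt zero_lt_one hne
        exact hb _ (Module.End.hasEigenvalue_adjoint_iff.1 hev) (by simpa using hν)
      simp [hbot]
  refine ⟨key, ?_, ?_⟩
  · rw [← key, Submodule.inf_orthogonal_eq_bot]
  · rw [← key, Submodule.sup_orthogonal_of_hasOrthogonalProjection]
end

section
/- Let E be a finite-dimensional complex inner product space, let b be an endomorphism of E none of whose eigenvalues lies on the imaginary axis iℝ, let V₊ be the sum of the generalized eigenspaces of b for eigenvalues with positive real part, and let V₋ be the sum of the generalized eigenspaces of the adjoint b* for eigenvalues with negative real part (so that E = V₊ ⊕ V₋ is an orthogonal decomposition). Let S be a selfadjoint positive definite endomorphism of E (⟨Se, e⟩ > 0 for all e ≠ 0). Then the linear map V₊ × V₋ → E, (e₊, e₋) ↦ −S e₊ + e₋, is bijective. -/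
open scoped ComplexInnerProductSpace

open Module.End Polynomial in
/-- Generalized eigenspaces of `b` at `lam` and of its adjoint at `μ` are orthogonal unless `μ` is
the conjugate of `lam`. -/
theorem isOrtho_maxGenEigenspace_adjoint
    {E : Type*} [NormedAddCommGroup E] [InnerProductSpace ℂ E] [FiniteDimensional ℂ E]
    (b : E →ₗ[ℂ] E) {lam μ : ℂ} (h : star lam ≠ μ) :
    maxGenEigenspace b lam ⟂ maxGenEigenspace (LinearMap.adjoint b) μ := by
  rw [Submodule.isOrtho_iff_inner_eq]
  intro x hx y hy
  obtain ⟨m, hm⟩ := (mem_maxGenEigenspace _ _ _).1 hx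
  obtain ⟨n, hn⟩ := (mem_maxGenEigenspace _ _ _).1 hy
  have haeval (ν : ℂ) : aeval (LinearMap.adjoint b) (X - C ν) =
      LinearMap.adjoint b - ν • (1 : Module.End ℂ E) := by
    simp [Algebra.algebraMap_eq_smul_one]
  obtain ⟨u, v, huv⟩ : IsCoprime ((X - C (star lam)) ^ m) ((X - C μ) ^ n) :=
    (isCoprime_X_sub_C_of_isUnit_sub (sub_ne_zero.2 h).isUnit).pow
  have hy' : ((LinearMap.adjoint b - star lam • (1 : Module.End ℂ E)) ^ m)
      (aeval (LinearMap.adjoint b) u y) = y := by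
    have := congrArg (fun p => aeval (LinearMap.adjoint b) p y) huv
    rw [mul_comm u] at this
    simpa only [map_add, map_mul, map_pow, haeval, map_one, LinearMap.add_apply,
      Module.End.mul_apply, Module.End.one_apply, hn, map_zero, add_zero] using this
  have hadj : LinearMap.adjoint ((b - lam • (1 : Module.End ℂ E)) ^ m) =
      (LinearMap.adjoint b - star lam • (1 : Module.End ℂ E)) ^ m := by
    simp only [← LinearMap.star_eq_adjoint, star_pow, star_sub, star_smul, star_one]
  rw [← hy', ← hadj, LinearMap.adjoint_inner_right, hm, inner_zero_left]

/-- The spectral subspace of `b` for a set `s` of eigenvalues is orthogonal to the spectral subspace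
of its adjoint for a set `t` containing no conjugate of an element of `s`. -/
theorem isOrtho_iSup_maxGenEigenspace_adjoint
    {E : Type*} [NormedAddCommGroup E] [InnerProductSpace ℂ E] [FiniteDimensional ℂ E]
    (b : E →ₗ[ℂ] E) {s t : ℂ → Prop} (hst : ∀ lam, s lam → ¬ t (star lam)) :
    (⨆ μ : ℂ, ⨆ _ : s μ, Module.End.maxGenEigenspace b μ) ⟂
      (⨆ μ : ℂ, ⨆ _ : t μ, Module.End.maxGenEigenspace (LinearMap.adjoint b) μ) := by
  simp only [Submodule.isOrtho_iSup_left, Submodule.isOrtho_iSup_right]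
  intro lam hlam μ hμ
  exact isOrtho_maxGenEigenspace_adjoint b fun h => hst _ hμ (h ▸ hlam)

theorem hasEigenvalue_star_of_adjoint
    {E : Type*} [NormedAddCommGroup E] [InnerProductSpace ℂ E] [FiniteDimensional ℂ E]
    {b : E →ₗ[ℂ] E} {μ : ℂ} (h : Module.End.HasEigenvalue (LinearMap.adjoint b) μ) :
    Module.End.HasEigenvalue b (star μ) := by
  rw [Module.End.hasEigenvalue_iff_mem_spectrum] at h ⊢
  rwa [← LinearMap.star_eq_adjoint, spectrum.map_star, Set.mem_star] at h

/-- If no eigenvalue of `b` is purely imaginary, the space is spanned by the spectral subspaces for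
the open left and right half-planes. -/
theorem iSup_maxGenEigenspace_re_pos_sup_re_neg
    {E : Type*} [AddCommGroup E] [Module ℂ E] [FiniteDimensional ℂ E] (b : Module.End ℂ E)
    (hb : ∀ μ : ℂ, Module.End.HasEigenvalue b μ → μ.re ≠ 0) :
    (⨆ μ : ℂ, ⨆ _ : 0 < μ.re, Module.End.maxGenEigenspace b μ) ⊔
      (⨆ μ : ℂ, ⨆ _ : μ.re < 0, Module.End.maxGenEigenspace b μ) = ⊤ := by
  rw [eq_top_iff, ← Module.End.iSup_maxGenEigenspace_eq_top b]
  refine iSup_le fun μ => ?_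
  rcases lt_trichotomy μ.re 0 with h | h | h
  · exact le_sup_of_le_right (le_iSup₂_of_le μ h le_rfl)
  · have hμ : Module.End.maxGenEigenspace b μ = ⊥ := by
      by_contra hne
      exact hb μ (Module.End.HasUnifEigenvalue.lt (k := ⊤) one_pos hne) h
    simp [hμ]
  · exact le_sup_of_le_left (le_iSup₂_of_le μ h le_rfl)

/-- The left half-plane spectral subspace of `b*` is the orthogonal complement of the right
half-plane spectral subspace of `b`. -/
theorem orthogonal_iSup_maxGenEigenspace_re_pos
    {E : Type*} [NormedAddCommGroup E] [InnerProductSpace ℂ E] [FiniteDimensional ℂ E]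
    (b : E →ₗ[ℂ] E) (hb : ∀ μ : ℂ, Module.End.HasEigenvalue b μ → μ.re ≠ 0) :
    (⨆ μ : ℂ, ⨆ _ : 0 < μ.re, Module.End.maxGenEigenspace b μ)ᗮ =
      ⨆ μ : ℂ, ⨆ _ : μ.re < 0, Module.End.maxGenEigenspace (LinearMap.adjoint b) μ := by
  have hpos := isOrtho_iSup_maxGenEigenspace_adjoint b (s := fun μ => 0 < μ.re)
    (t := fun μ => μ.re < 0) fun lam h => by simpa using h.le
  have hneg := isOrtho_iSup_maxGenEigenspace_adjoint b (s := fun μ => μ.re < 0)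
    (t := fun μ => 0 < μ.re) fun lam h => by simpa using h.le
  have hadj := iSup_maxGenEigenspace_re_pos_sup_re_neg (LinearMap.adjoint b) fun μ hμ => by
    simpa using hb _ (hasEigenvalue_star_of_adjoint hμ)
  refine le_antisymm (fun y hy => ?_) hpos.symm
  obtain ⟨p, hp, q, hq, rfl⟩ := Submodule.mem_sup.1 (hadj.ge (Submodule.mem_top (x := y)))
  have hp0 : p ∈ (⊤ : Submodule ℂ E)ᗮ := by
    rw [← iSup_maxGenEigenspace_re_pos_sup_re_neg b hb, ← Submodule.inf_orthogonal]
    exact ⟨by simpa using sub_mem hy (hpos.symm hq), hneg.symm hp⟩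
  rw [Submodule.top_orthogonal_eq_bot, Submodule.mem_bot] at hp0
  rwa [hp0, zero_add]

/-- If `S` is positive definite, then `(x, y) ↦ -S x + y` is a bijection from `K × Kᗮ` onto the
whole space. -/
theorem bijective_neg_apply_add_orthogonal
    {E : Type*} [NormedAddCommGroup E] [InnerProductSpace ℂ E] [FiniteDimensional ℂ E]
    (S : E →ₗ[ℂ] E) (hSpos : ∀ e : E, e ≠ 0 → 0 < (⟪S e, e⟫).re) (K : Submodule ℂ E) :
    Function.Bijective (fun p : K × Kᗮ => -S (p.1 : E) + (p.2 : E)) := by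
  let f : (K × Kᗮ) →ₗ[ℂ] E := (-(S ∘ₗ K.subtype)).coprod Kᗮ.subtype
  have hinj : Function.Injective f := by
    rw [← LinearMap.ker_eq_bot, LinearMap.ker_eq_bot']
    rintro ⟨x, y⟩ hxy
    have hSx : S x = y := neg_add_eq_zero.1 hxy
    have hx : x = 0 := by
      by_contra hne
      have hlt := hSpos x (by simpa using hne)
      rw [hSx, Submodule.inner_left_of_mem_orthogonal x.2 y.2] at hlt
      simp at hlt
    have hy : y = 0 := by
      rw [hx] at hSx
      simpa using hSx.symm
    rw [hx, hy, Prod.mk_zero_zero]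
  have hdim : Module.finrank ℂ (K × Kᗮ) = Module.finrank ℂ E := by
    rw [Module.finrank_prod, K.finrank_add_finrank_orthogonal]
  exact ⟨hinj, (LinearMap.injective_iff_surjective_of_finrank_eq_finrank hdim).1 hinj⟩

/-- Let `E` be a finite-dimensional complex inner product space,
`b` an endomorphism with no eigenvalues on the imaginary axis, `V₊` the sum of the
generalized eigenspaces of `b` for eigenvalues with positive real part and `V₋` the
sum of the generalized eigenspaces of `b*` for eigenvalues with negative real part
(so that `E = V₊ ⊕ V₋` orthogonally).  Let `S` be a selfadjoint positive definite
endomorphism of `E`.  Then the map `V₊ × V₋ → E`, `(e₊, e₋) ↦ −S e₊ + e₋`, is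
bijective. -/
theorem shapiro_lopatinskii_map_bijective
    {E : Type*} [NormedAddCommGroup E] [InnerProductSpace ℂ E] [FiniteDimensional ℂ E]
    (b : E →ₗ[ℂ] E)
    (hb : ∀ μ : ℂ, Module.End.HasEigenvalue b μ → μ.re ≠ 0)
    (S : E →ₗ[ℂ] E)
    (hSsa : LinearMap.IsSymmetric S)
    (hSpos : ∀ e : E, e ≠ 0 → 0 < (⟪S e, e⟫).re) :
    Function.Bijective
      (fun p : ↥(⨆ μ : ℂ, ⨆ _ : 0 < μ.re, Module.End.maxGenEigenspace b μ) ×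
          ↥(⨆ μ : ℂ, ⨆ _ : μ.re < 0,
              Module.End.maxGenEigenspace (LinearMap.adjoint b) μ) =>
        -S (p.1 : E) + (p.2 : E)) := by
  rw [← orthogonal_iSup_maxGenEigenspace_re_pos b hb]
  exact bijective_neg_apply_add_orthogonal S hSpos _
end

section
/- Let E be a finite-dimensional complex inner product space, let J be an invertible skew-adjoint endomorphism of E (J* = −J), define ω(x,y) := ⟨Jx, y⟩ and, for a subspace λ, λ^ω := {x ∈ E : ω(x,y) = 0 for all y ∈ λ}. Let b be an endomorphism of E satisfying Jb = −b*J, and let W_>, W₀, W_< denote respectively the sums of the generalized eigenspaces of b for eigenvalues with positive, zero, and negative real part. Then W_>^ω = W₀ + W_> and W_<^ω = W_< + W₀; in particular W_> and W_< are isotropic subspaces for ω. -/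
open scoped ComplexInnerProductSpace

/-- For an endomorphism `J` of a complex inner product space `E`, with associated
symplectic form `ω(x,y) = ⟪J x, y⟫`, this is the annihilator
`λ^ω = {x ∈ E : ω(x,y) = 0 for all y ∈ λ}` of a subspace `λ`. -/
def symplAnnLM {E : Type*} [NormedAddCommGroup E] [InnerProductSpace ℂ E]
    (J : E →ₗ[ℂ] E) (lam : Submodule ℂ E) : Submodule ℂ E where
  carrier := {x | ∀ y ∈ lam, ⟪J x, y⟫ = 0}
  add_mem' := by
    intro a b ha hb y hy
    simp [map_add, inner_add_left, ha y hy, hb y hy]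
  zero_mem' := by
    intro y hy
    simp
  smul_mem' := by
    intro c x hx y hy
    simp [map_smul, inner_smul_left, hx y hy]

/-- If `⟪J (b x), y⟫ = -⟪J x, b y⟫`, generalized eigenvectors of `b` at `μ` and `ν` are orthogonal
for the form `⟪J x, y⟫` as soon as `μ ≠ -conj ν`. -/
theorem inner_eq_zero_of_mem_maxGenEigenspace
    {E : Type*} [NormedAddCommGroup E] [InnerProductSpace ℂ E] [FiniteDimensional ℂ E]
    {J b : E →ₗ[ℂ] E} (hJb : ∀ x y, ⟪J (b x), y⟫ = -⟪J x, b y⟫)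
    {μ ν : ℂ} (hμν : μ ≠ -starRingEnd ℂ ν) {x y : E}
    (hx : x ∈ Module.End.maxGenEigenspace b μ) (hy : y ∈ Module.End.maxGenEigenspace b ν) :
    ⟪J x, y⟫ = 0 := by
  obtain ⟨N, hN⟩ := (Module.End.mem_maxGenEigenspace b ν y).1 hy
  let c : Module.End ℂ E := b - algebraMap ℂ (Module.End ℂ E) (-starRingEnd ℂ ν)
  have hmaps : ∀ z ∈ Module.End.maxGenEigenspace b μ, c z ∈ Module.End.maxGenEigenspace b μ :=
    Module.End.mapsTo_maxGenEigenspace_of_comm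
      ((Commute.refl b).sub_right (Algebra.commutes _ b).symm) μ
  have hinj : Function.Injective (c.restrict hmaps) := by
    rw [← LinearMap.ker_eq_bot, LinearMap.ker_eq_bot']
    rintro ⟨z, hz⟩ hcz
    have hcz' : c z = 0 := congrArg Subtype.val hcz
    have hz' : z ∈ Module.End.maxGenEigenspace b (-starRingEnd ℂ ν) :=
      (Module.End.mem_maxGenEigenspace b _ z).2 ⟨1, by
        simpa [c, Algebra.algebraMap_eq_smul_one] using hcz'⟩
    exact Subtype.ext (Submodule.disjoint_def.1
      (Module.End.disjoint_genEigenspace b hμν ⊤ ⊤) z hz hz')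
  have hadj : ∀ u v, ⟪J (c u), v⟫ = -⟪J u, (b - ν • (1 : Module.End ℂ E)) v⟫ := by
    intro u v
    simp [c, hJb]
    ring
  have hpow : ∀ (n : ℕ) (u v : E),
      ⟪J ((c ^ n) u), v⟫ = (-1) ^ n * ⟪J u, ((b - ν • (1 : Module.End ℂ E)) ^ n) v⟫ := by
    intro n
    induction n with
    | zero => simp
    | succ n ih =>
      intro u v
      rw [pow_succ, Module.End.mul_apply, ih, hadj, pow_succ', pow_succ', Module.End.mul_apply]
      ring
  obtain ⟨⟨u, hu⟩, hux⟩ := (LinearMap.injective_iff_surjective.1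
    (by rw [Module.End.coe_pow]; exact hinj.iterate N :
      Function.Injective ((c.restrict hmaps) ^ N))) ⟨x, hx⟩
  have hux' : (c ^ N) u = x := by
    rw [Module.End.pow_restrict] at hux
    exact congrArg Subtype.val hux
  rw [← hux', hpow, hN, inner_zero_right, mul_zero]

/-- Sums of generalized eigenspaces over sets of eigenvalues `P`, `Q` are mutually orthogonal for
`⟪J x, y⟫` when no real part from `P` is opposite to one from `Q`. -/
theorem iSup_maxGenEigenspace_le_symplAnnLM
    {E : Type*} [NormedAddCommGroup E] [InnerProductSpace ℂ E] [FiniteDimensional ℂ E]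
    {J b : E →ₗ[ℂ] E} (hJb : ∀ x y, ⟪J (b x), y⟫ = -⟪J x, b y⟫)
    {P Q : ℂ → Prop} (hPQ : ∀ μ ν, P μ → Q ν → μ.re ≠ -ν.re) :
    (⨆ μ : ℂ, ⨆ _ : P μ, Module.End.maxGenEigenspace b μ) ≤
      symplAnnLM J (⨆ μ : ℂ, ⨆ _ : Q μ, Module.End.maxGenEigenspace b μ) := by
  refine iSup₂_le fun μ hμ x hx => ?_
  have hle : (⨆ ν : ℂ, ⨆ _ : Q ν, Module.End.maxGenEigenspace b ν) ≤
      LinearMap.ker (innerₛₗ ℂ (J x)) := by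
    refine iSup₂_le fun ν hν y hy => ?_
    refine inner_eq_zero_of_mem_maxGenEigenspace hJb (fun h => hPQ μ ν hμ hν ?_) hx hy
    simpa using congrArg Complex.re h
  exact fun y hy => hle hy

/-- The annihilator of the sum of generalized eigenspaces over `Q` is the sum over `P`, when no real
part from `P` is opposite to one from `Q`, and likewise for the complements. -/
theorem symplAnnLM_iSup_maxGenEigenspace
    {E : Type*} [NormedAddCommGroup E] [InnerProductSpace ℂ E] [FiniteDimensional ℂ E]
    {J b : E →ₗ[ℂ] E} (hJ : Function.Injective J) (hJb : ∀ x y, ⟪J (b x), y⟫ = -⟪J x, b y⟫)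
    {P Q : ℂ → Prop} (hPQ : ∀ μ ν, P μ → Q ν → μ.re ≠ -ν.re)
    (hPQ' : ∀ μ ν, ¬P μ → ¬Q ν → μ.re ≠ -ν.re) :
    symplAnnLM J (⨆ μ : ℂ, ⨆ _ : Q μ, Module.End.maxGenEigenspace b μ) =
      ⨆ μ : ℂ, ⨆ _ : P μ, Module.End.maxGenEigenspace b μ := by
  have htop : ∀ R : ℂ → Prop, (⨆ μ : ℂ, ⨆ _ : R μ, Module.End.maxGenEigenspace b μ) ⊔
      (⨆ μ : ℂ, ⨆ _ : ¬R μ, Module.End.maxGenEigenspace b μ) = ⊤ := by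
    intro R
    rw [← Module.End.iSup_maxGenEigenspace_eq_top b, ← iSup_sup_eq]
    exact iSup_congr fun μ => by by_cases h : R μ <;> simp [h]
  have hle := iSup_maxGenEigenspace_le_symplAnnLM hJb hPQ
  refine le_antisymm (fun x hx => ?_) hle
  obtain ⟨u, hu, v, hv, rfl⟩ := Submodule.mem_sup.1 (htop P ▸ Submodule.mem_top : x ∈ _)
  have hvQ := (Submodule.add_mem_iff_right _ (hle hu)).1 hx
  have hvQ' := iSup_maxGenEigenspace_le_symplAnnLM hJb hPQ' hv
  have hJv : J v = 0 := by
    rw [← inner_self_eq_zero (𝕜 := ℂ)]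
    obtain ⟨y, hy, z, hz, hyz⟩ := Submodule.mem_sup.1 (htop Q ▸ Submodule.mem_top : J v ∈ _)
    nth_rewrite 2 [← hyz]
    rw [inner_add_right, hvQ y hy, hvQ' z hz, add_zero]
  rw [hJ (hJv.trans (map_zero J).symm), add_zero]
  exact hu

/-- Let `E` be a finite-dimensional complex inner product space,
`J` an invertible skew-adjoint endomorphism (`J* = −J`), `ω(x,y) = ⟪Jx, y⟫`, and `b`
an endomorphism with `Jb = −b*J`.  Let `W_>`, `W₀`, `W_<` be the sums of the
generalized eigenspaces of `b` for eigenvalues with positive, zero and negative real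
part respectively.  Then `W_>^ω = W₀ + W_>` and `W_<^ω = W_< + W₀`; in particular
`W_>` and `W_<` are isotropic subspaces for `ω`. -/
theorem annihilators_of_spectral_subspaces
    {E : Type*} [NormedAddCommGroup E] [InnerProductSpace ℂ E] [FiniteDimensional ℂ E]
    (J : E →ₗ[ℂ] E)
    (hJinv : Function.Bijective J)
    (hJskew : LinearMap.adjoint J = -J)
    (b : E →ₗ[ℂ] E)
    (hJb : J ∘ₗ b = -(LinearMap.adjoint b ∘ₗ J)) :
    symplAnnLM J (⨆ μ : ℂ, ⨆ _ : 0 < μ.re, Module.End.maxGenEigenspace b μ) =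
      (⨆ μ : ℂ, ⨆ _ : μ.re = 0, Module.End.maxGenEigenspace b μ) ⊔
        (⨆ μ : ℂ, ⨆ _ : 0 < μ.re, Module.End.maxGenEigenspace b μ) ∧
    symplAnnLM J (⨆ μ : ℂ, ⨆ _ : μ.re < 0, Module.End.maxGenEigenspace b μ) =
      (⨆ μ : ℂ, ⨆ _ : μ.re < 0, Module.End.maxGenEigenspace b μ) ⊔
        (⨆ μ : ℂ, ⨆ _ : μ.re = 0, Module.End.maxGenEigenspace b μ) ∧
    (⨆ μ : ℂ, ⨆ _ : 0 < μ.re, Module.End.maxGenEigenspace b μ) ≤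
      symplAnnLM J (⨆ μ : ℂ, ⨆ _ : 0 < μ.re, Module.End.maxGenEigenspace b μ) ∧
    (⨆ μ : ℂ, ⨆ _ : μ.re < 0, Module.End.maxGenEigenspace b μ) ≤
      symplAnnLM J (⨆ μ : ℂ, ⨆ _ : μ.re < 0, Module.End.maxGenEigenspace b μ) := by
  have hω : ∀ x y, ⟪J (b x), y⟫ = -⟪J x, b y⟫ := by
    intro x y
    rw [← LinearMap.comp_apply, hJb]
    simp [LinearMap.adjoint_inner_left]
  refine ⟨?_, ?_, ?_, ?_⟩
  · rw [symplAnnLM_iSup_maxGenEigenspace (P := fun μ => μ.re = 0 ∨ 0 < μ.re) hJinv.1 hω]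
    · simp_rw [iSup_or, iSup_sup_eq]
    all_goals grind
  · rw [symplAnnLM_iSup_maxGenEigenspace (P := fun μ => μ.re < 0 ∨ μ.re = 0) hJinv.1 hω]
    · simp_rw [iSup_or, iSup_sup_eq]
    all_goals grind
  all_goals exact iSup_maxGenEigenspace_le_symplAnnLM hω (by grind)
end
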